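/- Let T be a C_{2,ϖ} orientation-preserving circle diffeomorphism with irrational rotation number ρ. If Σ_{n=0}^{∞} k_{n+1} τₙ < +∞, where τₙ := Σ_{k=0}^{n} (lₙ/l_{n−k}) ϖ(l_{n−k−1}) with l₋₁ := 1, then T admits a C¹ conjugacy to the rigid rotation R_ρ. -/

import Mathlib

/-- A modulus of continuity. -/
structure IsModulus (w : ℝ → ℝ) : Prop where
  pos : ∀ x : ℝ, 0 < x → 0 < w x
  strictMono : StrictMonoOn w (Set.Ioi 0)
  continuous : ContinuousOn w (Set.Ioi 0)
  subadd : ∀ x y : ℝ, 0 < x → 0 < y → w (x + y) ≤ w x + w y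
  tendsto : Filter.Tendsto w (nhdsWithin 0 (Set.Ioi 0)) (nhds 0)

open Filter Topology Set

/-- `P n / Q n` is the sequence of continued fraction convergents of the irrational number `ρ`,
with partial quotients `K`, starting from the formal convergent `1 / 0`. -/
structure IsConvergents (ρ : ℝ) (K P Q : ℕ → ℕ) : Prop where
  irrational : Irrational ρ
  one_le : ∀ n, 1 ≤ K n
  P_zero : P 0 = 1
  P_one : P 1 = 0
  Q_zero : Q 0 = 0
  Q_one : Q 1 = 1
  P_rec : ∀ n, P (n + 2) = K n * P (n + 1) + P n
  Q_rec : ∀ n, Q (n + 2) = K n * Q (n + 1) + Q n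
  tendsto : Tendsto (fun n => (P n : ℝ) / (Q n : ℝ)) atTop (𝓝 ρ)

namespace IsConvergents

variable {ρ : ℝ} {K P Q : ℕ → ℕ}

theorem Q_add_le (h : IsConvergents ρ K P Q) (n : ℕ) : Q (n + 1) + Q n ≤ Q (n + 2) := by
  rw [h.Q_rec n]
  have := Nat.le_mul_of_pos_left (Q (n + 1)) (h.one_le n)
  omega

theorem Q_le_succ (h : IsConvergents ρ K P Q) (n : ℕ) : Q n ≤ Q (n + 1) := by
  rcases n with _ | n
  · simp [h.Q_zero]
  · exact (Nat.le_add_right _ _).trans (h.Q_add_le n)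

theorem Q_mono (h : IsConvergents ρ K P Q) : Monotone Q := monotone_nat_of_le_succ h.Q_le_succ

theorem Q_pos (h : IsConvergents ρ K P Q) (n : ℕ) : 1 ≤ Q (n + 1) :=
  h.Q_one.symm.trans_le (h.Q_mono (Nat.le_add_left 1 n))

/-- Signed distance from `Q n * ρ` to `P n`. -/
def err (ρ : ℝ) (P Q : ℕ → ℕ) (n : ℕ) : ℝ := Q n * ρ - P n

theorem err_rec (h : IsConvergents ρ K P Q) (n : ℕ) :
    err ρ P Q (n + 2) = K n * err ρ P Q (n + 1) + err ρ P Q n := by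
  simp only [err, h.P_rec, h.Q_rec]
  push_cast
  ring

theorem err_ne_zero (h : IsConvergents ρ K P Q) (n : ℕ) : err ρ P Q n ≠ 0 := by
  rcases n with _ | n
  · simp [err, h.Q_zero, h.P_zero]
  · have h1 : Irrational ((Q (n + 1) : ℝ) * ρ) :=
      h.irrational.natCast_mul (by have := h.Q_pos n; omega)
    exact sub_ne_zero.2 (h1.ne_nat _)

theorem not_same_sign (h : IsConvergents ρ K P Q) (s : ℝ) (n : ℕ)
    (h0 : 0 < s * err ρ P Q n) (h1 : 0 < s * err ρ P Q (n + 1)) : False := by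
  obtain ⟨c, hc, hc0, hc1⟩ : ∃ c : ℝ, 0 < c ∧ c * Q n ≤ s * err ρ P Q n ∧
      c * Q (n + 1) ≤ s * err ρ P Q (n + 1) := by
    refine ⟨min (s * err ρ P Q n / (Q n + 1)) (s * err ρ P Q (n + 1) / (Q (n + 1) + 1)),
      lt_min (by positivity) (by positivity), ?_, ?_⟩
    · calc _ ≤ s * err ρ P Q n / (Q n + 1) * (Q n + 1) := by
            gcongr
            · exact min_le_left _ _
            · linarith
        _ = _ := by field_simp
    · calc _ ≤ s * err ρ P Q (n + 1) / (Q (n + 1) + 1) * (Q (n + 1) + 1) := by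
            gcongr
            · exact min_le_right _ _
            · linarith
        _ = _ := by field_simp
  have key : ∀ m, c * Q (n + m) ≤ s * err ρ P Q (n + m) ∧
      c * Q (n + m + 1) ≤ s * err ρ P Q (n + m + 1) := by
    intro m
    induction m with
    | zero => exact ⟨hc0, hc1⟩
    | succ m ih =>
      refine ⟨ih.2, ?_⟩
      rw [show n + (m + 1) + 1 = n + m + 2 by ring, h.err_rec, h.Q_rec]
      push_cast
      have := mul_le_mul_of_nonneg_left ih.2 (Nat.cast_nonneg (α := ℝ) (K (n + m)))
      linarith [ih.1]
  have hlim : Tendsto (fun m => s * (ρ - (P m : ℝ) / Q m)) atTop (𝓝 (s * (ρ - ρ))) :=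
    (tendsto_const_nhds.sub h.tendsto).const_mul s
  have : c ≤ s * (ρ - ρ) := by
    refine ge_of_tendsto hlim ?_
    filter_upwards [eventually_ge_atTop (n + 1)] with m hm
    obtain ⟨d, rfl⟩ := Nat.exists_eq_add_of_le hm
    have h2 := (key d).2
    have hQ : (0 : ℝ) < Q (n + 1 + d) := by
      have := h.Q_pos (n + d)
      rw [show n + d + 1 = n + 1 + d by ring] at this
      exact_mod_cast this
    rw [show n + d + 1 = n + 1 + d by ring, err] at h2
    have : s * (ρ - (P (n + 1 + d) : ℝ) / Q (n + 1 + d))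
        = s * (Q (n + 1 + d) * ρ - P (n + 1 + d)) / Q (n + 1 + d) := by field_simp
    rw [this, le_div_iff₀ hQ]
    exact h2
  simp at this
  linarith

theorem err_mul_neg (h : IsConvergents ρ K P Q) (n : ℕ) :
    err ρ P Q n * err ρ P Q (n + 1) < 0 := by
  rcases lt_or_gt_of_ne (h.err_ne_zero n) with h0 | h0 <;>
  rcases lt_or_gt_of_ne (h.err_ne_zero (n + 1)) with h1 | h1
  · exact (h.not_same_sign (-1) n (by linarith) (by linarith)).elim
  · exact mul_neg_of_neg_of_pos h0 h1
  · exact mul_neg_of_pos_of_neg h0 h1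
  · exact (h.not_same_sign 1 n (by linarith) (by linarith)).elim

theorem abs_err_succ_le (h : IsConvergents ρ K P Q) (n : ℕ) :
    |err ρ P Q (n + 1)| ≤ |err ρ P Q n| := by
  have h0 := h.err_mul_neg n
  have h1 := h.err_mul_neg (n + 1)
  have hr := h.err_rec n
  have hK : (1 : ℝ) ≤ K n := by exact_mod_cast h.one_le n
  rw [show n + 1 + 1 = n + 2 by ring] at h1
  rcases lt_or_gt_of_ne (h.err_ne_zero (n + 1)) with hs | hs
  · have h2 : 0 < err ρ P Q n := by nlinarith
    have h3 : 0 < err ρ P Q (n + 2) := by nlinarith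
    rw [abs_of_neg hs, abs_of_pos h2]
    nlinarith
  · have h2 : err ρ P Q n < 0 := by nlinarith
    have h3 : err ρ P Q (n + 2) < 0 := by nlinarith
    rw [abs_of_pos hs, abs_of_neg h2]
    nlinarith

theorem abs_err_le_one (h : IsConvergents ρ K P Q) (n : ℕ) : |err ρ P Q n| ≤ 1 := by
  induction n with
  | zero => simp [err, h.Q_zero, h.P_zero]
  | succ n ih => exact (h.abs_err_succ_le n).trans ih

theorem det (h : IsConvergents ρ K P Q) (n : ℕ) :
    (Q (n + 1) : ℤ) * P n - Q n * P (n + 1) = (-1) ^ n := by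
  induction n with
  | zero => simp [h.Q_zero, h.P_zero, h.Q_one, h.P_one]
  | succ n ih =>
    rw [h.Q_rec, h.P_rec, pow_succ, ← ih]
    push_cast
    ring

/-- Best approximation property of the convergents. -/
theorem abs_err_le (h : IsConvergents ρ K P Q) (n r : ℕ) (hr : r < Q (n + 1)) (m : ℤ)
    (h0 : r ≠ 0 ∨ m ≠ 0) : |err ρ P Q n| ≤ |r * ρ + m| := by
  rcases Nat.eq_zero_or_pos r with rfl | hr0
  · have hm : m ≠ 0 := by simpa using h0
    have : (1 : ℝ) ≤ |(m : ℝ)| := by exact_mod_cast Int.one_le_abs hm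
    simpa using (h.abs_err_le_one n).trans this
  obtain ⟨a, b, h1, h2⟩ : ∃ a b : ℤ, (r : ℤ) = a * Q n + b * Q (n + 1) ∧
      -m = a * P n + b * P (n + 1) := by
    have hd := h.det n
    have hs : ((-1 : ℤ) ^ n) * (-1) ^ n = 1 := by
      rw [← mul_pow]; simp
    refine ⟨(-1) ^ n * (-m * Q (n + 1) - r * P (n + 1)), (-1) ^ n * (r * P n + m * Q n), ?_, ?_⟩
    · linear_combination (-(r : ℤ)) * hs - (-1) ^ n * (r : ℤ) * hd
    · linear_combination m * hs + (-1) ^ n * m * hd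
  have ha : a ≠ 0 := by
    rintro rfl
    have : (0 : ℤ) < b := by
      by_contra hb
      have : b * (Q (n + 1) : ℤ) ≤ 0 := mul_nonpos_of_nonpos_of_nonneg (by omega) (by positivity)
      omega
    nlinarith
  have hab : a * b ≤ 0 := by
    by_contra! hab
    have hQ := h.Q_pos n
    rcases pos_and_pos_or_neg_and_neg_of_mul_pos hab with ⟨h3, h4⟩ | ⟨h3, h4⟩
    · have : 0 ≤ a * (Q n : ℤ) := by positivity
      nlinarith
    · have : a * (Q n : ℤ) ≤ 0 := mul_nonpos_of_nonpos_of_nonneg h3.le (by positivity)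
      nlinarith
  have heq : (r : ℝ) * ρ + m = a * err ρ P Q n + b * err ρ P Q (n + 1) := by
    have h1' : (r : ℝ) = a * Q n + b * Q (n + 1) := by exact_mod_cast h1
    have h2' : -(m : ℝ) = a * P n + b * P (n + 1) := by exact_mod_cast h2
    simp only [err]
    linear_combination ρ * h1' - h2'
  have hprod : 0 ≤ (a * err ρ P Q n) * (b * err ρ P Q (n + 1)) := by
    have : ((a * b : ℤ) : ℝ) ≤ 0 := by exact_mod_cast hab
    push_cast at this
    nlinarith [h.err_mul_neg n]
  have h1a : (1 : ℝ) ≤ |(a : ℝ)| := by exact_mod_cast Int.one_le_abs ha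
  rw [heq, abs_add_eq_add_abs_iff _ _ |>.2 ?_, abs_mul]
  · nlinarith [abs_nonneg (err ρ P Q n), abs_nonneg ((b : ℝ) * err ρ P Q (n + 1))]
  · rcases mul_nonneg_iff.1 hprod with h | h
    · exact Or.inl h
    · exact Or.inr h

end IsConvergents

/-- Intervals whose integer translates are pairwise disjoint have total length at most one. -/
theorem sum_length_le_one_of_disjoint (N : ℕ) (a b : ℕ → ℝ) (hab : ∀ i < N, a i ≤ b i)
    (hd : ∀ i < N, ∀ j < N, ∀ m : ℤ, i ≠ j ∨ m ≠ 0 →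
      Disjoint (Ioo (a i) (b i)) (Ioo (a j + m) (b j + m))) :
    ∑ i ∈ Finset.range N, (b i - a i) ≤ 1 := by
  set s : Set ℝ := ⋃ i ∈ Finset.range N, Ioo (a i) (b i) with hs
  have hvol : MeasureTheory.volume s = ENNReal.ofReal (∑ i ∈ Finset.range N, (b i - a i)) := by
    rw [hs, MeasureTheory.measure_biUnion_finset, ENNReal.ofReal_sum_of_nonneg]
    · simp
    · intro i hi
      linarith [hab i (Finset.mem_range.1 hi)]
    · intro i hi j hj hij
      simpa using hd i (by simpa using hi) j (by simpa using hj) 0 (Or.inl hij)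
    · exact fun i _ => measurableSet_Ioo
  have hsm : MeasurableSet s := Finset.measurableSet_biUnion _ fun i _ => measurableSet_Ioo
  by_contra! hlt
  have hF := isAddFundamentalDomain_Ioc (T := (1 : ℝ)) one_pos 0 MeasureTheory.volume
  obtain ⟨x, y, hxy, hnd⟩ := MeasureTheory.exists_pair_mem_lattice_not_disjoint_vadd
    (s := s) hF hsm.nullMeasurableSet (by
      rw [hvol, Real.volume_Ioc]
      exact (ENNReal.ofReal_lt_ofReal_iff (by linarith)).2 (by simpa using hlt))
  obtain ⟨z, hz1, hz2⟩ := Set.not_disjoint_iff.1 hnd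
  obtain ⟨u, hu, rfl⟩ := hz1
  obtain ⟨v, hv, huv⟩ := hz2
  simp only [hs, Set.mem_iUnion, Finset.mem_range] at hu hv
  obtain ⟨i, hi, hu⟩ := hu
  obtain ⟨j, hj, hv⟩ := hv
  obtain ⟨⟨x, hx⟩, ⟨y, hy⟩⟩ := x, y
  obtain ⟨mx, rfl⟩ := AddSubgroup.mem_zmultiples_iff.1 hx
  obtain ⟨my, rfl⟩ := AddSubgroup.mem_zmultiples_iff.1 hy
  simp only [zsmul_eq_mul, mul_one, AddSubgroup.mk_vadd, vadd_eq_add] at huv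
  refine Set.disjoint_left.1 (hd i hi j hj (my - mx) (Or.inr ?_)) hu ?_
  · intro h0
    exact hxy (by simp [sub_eq_zero.1 h0])
  · push_cast
    constructor <;> linarith [hv.1, hv.2]

/-- A modulus of continuity dominates a linear function on `(0, 1]`. -/
theorem IsModulus.linear_le {w : ℝ → ℝ} (hw : IsModulus w) {r : ℝ} (h0 : 0 < r) (h1 : r ≤ 1) :
    r * w 1 ≤ 2 * w r := by
  have hmul : ∀ n : ℕ, w ((n + 1 : ℕ) * r) ≤ (n + 1 : ℕ) * w r := by
    intro n
    induction n with
    | zero => simp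
    | succ n ih =>
      calc w ((n + 1 + 1 : ℕ) * r) = w ((n + 1 : ℕ) * r + r) := by push_cast; ring_nf
        _ ≤ w ((n + 1 : ℕ) * r) + w r := hw.subadd _ _ (by positivity) h0
        _ ≤ _ := by push_cast at *; linarith
  obtain ⟨n, hn⟩ : ∃ n : ℕ, n = ⌊1 / r⌋₊ := ⟨_, rfl⟩
  have h2 : 1 / r < n + 1 := hn ▸ Nat.lt_floor_add_one _
  have h3 : (n : ℝ) ≤ 1 / r := hn ▸ Nat.floor_le (by positivity)
  rw [div_lt_iff₀ h0] at h2
  rw [le_div_iff₀ h0] at h3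
  have h4 : w 1 ≤ (n + 1 : ℕ) * w r :=
    (hw.strictMono.monotoneOn (mem_Ioi.2 one_pos)
      (mem_Ioi.2 (by positivity)) (by push_cast; exact h2.le)).trans (hmul n)
  have h5 := mul_le_mul_of_nonneg_left h4 h0.le
  have h6 := hw.pos r h0
  push_cast at h5
  nlinarith

/-- `F` is a lift of a `C^{2,w}` circle diffeomorphism with derivatives `F'` and `F''`. -/
structure IsSmoothLift (w F F' F'' : ℝ → ℝ) : Prop where
  modulus : IsModulus w
  strictMono : StrictMono F
  map_add_one : ∀ x, F (x + 1) = F x + 1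
  hasDerivAt : ∀ x, HasDerivAt F (F' x) x
  hasDerivAt' : ∀ x, HasDerivAt F' (F'' x) x
  pos : ∀ x, 0 < F' x
  holder : ∀ x y : ℝ, x ≠ y → |F'' x - F'' y| ≤ w |x - y|

namespace IsSmoothLift

variable {w F F' F'' : ℝ → ℝ}

theorem deriv_add_one (h : IsSmoothLift w F F' F'') (x : ℝ) : F' (x + 1) = F' x := by
  have h1 : HasDerivAt (fun y => F (y + 1)) (F' (x + 1)) x :=
    (h.hasDerivAt (x + 1)).comp_add_const x 1
  have h2 : HasDerivAt (fun y => F (y + 1)) (F' x) x := by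
    simp only [h.map_add_one]
    exact (h.hasDerivAt x).add_const 1
  exact h1.unique h2

theorem deriv_deriv_add_one (h : IsSmoothLift w F F' F'') (x : ℝ) : F'' (x + 1) = F'' x := by
  have h1 : HasDerivAt (fun y => F' (y + 1)) (F'' (x + 1)) x :=
    (h.hasDerivAt' (x + 1)).comp_add_const x 1
  have h2 : HasDerivAt (fun y => F' (y + 1)) (F'' x) x := by
    simp only [h.deriv_add_one]
    exact h.hasDerivAt' x
  exact h1.unique h2

theorem continuous (h : IsSmoothLift w F F' F'') : Continuous F :=
  continuous_iff_continuousAt.2 fun x => (h.hasDerivAt x).continuousAt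

theorem continuous_deriv (h : IsSmoothLift w F F' F'') : Continuous F' :=
  continuous_iff_continuousAt.2 fun x => (h.hasDerivAt' x).continuousAt

theorem continuous_deriv_deriv (h : IsSmoothLift w F F' F'') : Continuous F'' := by
  refine Metric.continuous_iff.2 fun x ε hε => ?_
  obtain ⟨δ, hδ, hδ'⟩ := Metric.tendsto_nhdsWithin_nhds.1 h.modulus.tendsto ε hε
  refine ⟨δ, hδ, fun y hy => ?_⟩
  rcases eq_or_ne y x with rfl | hne
  · simpa
  · have h1 : 0 < |y - x| := abs_pos.2 (sub_ne_zero.2 hne)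
    have h2 := hδ' (mem_Ioi.2 h1) (by simpa [Real.dist_eq] using hy)
    rw [Real.dist_eq, sub_zero] at h2
    rw [Real.dist_eq]
    exact (h.holder y x hne).trans_lt ((le_abs_self _).trans_lt h2)

end IsSmoothLift

/-- A continuous `1`-periodic function has a positive upper bound. -/
theorem exists_bound_of_periodic {f : ℝ → ℝ} (hf : Continuous f) (hp : ∀ x, f (x + 1) = f x) :
    ∃ C, 0 < C ∧ ∀ x, |f x| ≤ C := by
  obtain ⟨C, hC⟩ := isCompact_Icc.exists_bound_of_continuousOn (s := Icc (0 : ℝ) 1) hf.continuousOn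
  refine ⟨max C 1, by positivity, fun x => ?_⟩
  have hper : Function.Periodic f 1 := hp
  obtain ⟨y, hy, hxy⟩ := hper.exists_mem_Ico₀ one_pos x
  rw [hxy]
  exact (hC y ⟨hy.1, hy.2.le⟩).trans (le_max_left _ _)

namespace IsSmoothLift

variable {w F F' F'' : ℝ → ℝ}

theorem exists_bounds (h : IsSmoothLift w F F' F'') :
    ∃ c b : ℝ, 0 < c ∧ 0 < b ∧ ∀ x, c ≤ F' x ∧ |F'' x| ≤ b := by
  obtain ⟨b, hb, hb'⟩ := exists_bound_of_periodic h.continuous_deriv_deriv h.deriv_deriv_add_one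
  obtain ⟨c, hc, hcinv⟩ := exists_bound_of_periodic (f := fun x => (F' x)⁻¹)
    (h.continuous_deriv.inv₀ fun x => (h.pos x).ne') fun x => by rw [h.deriv_add_one]
  refine ⟨c⁻¹, b, by positivity, hb, fun x => ⟨?_, hb' x⟩⟩
  exact inv_le_of_inv_le₀ (h.pos x) ((le_abs_self _).trans (hcinv x))

/-- Mean value theorem for `F`. -/
theorem exists_slope (h : IsSmoothLift w F F' F'') (x y : ℝ) :
    ∃ ξ ∈ uIcc x y, F x - F y = F' ξ * (x - y) := by
  wlog hxy : x < y generalizing x y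
  · rcases eq_or_lt_of_le (not_lt.1 hxy) with rfl | hlt
    · exact ⟨y, left_mem_uIcc, by simp⟩
    · obtain ⟨ξ, h1, h2⟩ := this y x hlt
      exact ⟨ξ, by rwa [uIcc_comm], by linarith⟩
  · obtain ⟨ξ, h1, h2⟩ := exists_hasDerivAt_eq_slope F F' hxy h.continuous.continuousOn
      fun t _ => h.hasDerivAt t
    refine ⟨ξ, Icc_subset_uIcc (Ioo_subset_Icc_self h1), ?_⟩
    have : y - x ≠ 0 := by linarith
    rw [h2]
    field_simp
    ring

theorem exists_log_deriv_lipschitz (h : IsSmoothLift w F F' F'') :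
    ∃ B, 0 < B ∧ ∀ x y, |Real.log (F' x) - Real.log (F' y)| ≤ B * |x - y| := by
  obtain ⟨c, b, hc, hb, hbd⟩ := h.exists_bounds
  refine ⟨b / c, by positivity, fun x y => ?_⟩
  have := Convex.norm_image_sub_le_of_norm_hasDerivWithin_le (s := univ) (C := b / c)
    (f := fun x => Real.log (F' x)) (f' := fun x => F'' x / F' x) (x := y) (y := x)
    (fun t _ => ((h.hasDerivAt' t).log (h.pos t).ne').hasDerivWithinAt)
    (fun t _ => ?_) convex_univ (mem_univ _) (mem_univ _)
  · simpa using this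
  · rw [norm_div, Real.norm_eq_abs, Real.norm_eq_abs, abs_of_pos (h.pos t)]
    exact div_le_div₀ hb.le (hbd t).2 hc (hbd t).1

/-- Logarithm of the difference quotient of `F`, extended by `log F'` to the diagonal. -/
noncomputable def logSlope (F : ℝ → ℝ) (x y : ℝ) : ℝ := Real.log (dslope F x y)

theorem dslope_pos (h : IsSmoothLift w F F' F'') (x y : ℝ) : 0 < dslope F x y := by
  rcases eq_or_ne y x with rfl | hne
  · rw [dslope_same, (h.hasDerivAt y).deriv]
    exact h.pos y
  · rw [dslope_of_ne _ hne]
    obtain ⟨ξ, -, h1⟩ := h.exists_slope y x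
    rw [slope_def_field, h1, mul_div_cancel_right₀ _ (sub_ne_zero.2 hne)]
    exact h.pos ξ

theorem logSlope_self (h : IsSmoothLift w F F' F'') (x : ℝ) :
    logSlope F x x = Real.log (F' x) := by
  rw [logSlope, dslope_same, (h.hasDerivAt x).deriv]

theorem sub_eq_exp_logSlope (h : IsSmoothLift w F F' F'') (x y : ℝ) :
    F y - F x = Real.exp (logSlope F x y) * (y - x) := by
  rw [logSlope, Real.exp_log (h.dslope_pos x y), mul_comm, ← smul_eq_mul, sub_smul_dslope]

theorem logSlope_comm (x y : ℝ) : logSlope F x y = logSlope F y x := by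
  rcases eq_or_ne y x with rfl | hne
  · rfl
  · rw [logSlope, logSlope, dslope_of_ne _ hne, dslope_of_ne _ hne.symm, slope_comm]

theorem exists_logSlope_eq (h : IsSmoothLift w F F' F'') (x y : ℝ) :
    ∃ ξ ∈ uIcc x y, logSlope F x y = Real.log (F' ξ) := by
  rcases eq_or_ne y x with rfl | hne
  · exact ⟨y, left_mem_uIcc, h.logSlope_self y⟩
  · obtain ⟨ξ, h0, h1⟩ := h.exists_slope x y
    refine ⟨ξ, h0, ?_⟩
    rw [logSlope, dslope_of_ne _ hne, slope_comm, slope_def_field, h1,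
      mul_div_cancel_right₀ _ (sub_ne_zero.2 hne.symm)]

/-- Second order Taylor estimate at `t`. -/
theorem taylor_bound (h : IsSmoothLift w F F' F'') {r z t : ℝ} (htz : |z - t| ≤ r) :
    |F t - F z - F' t * (t - z) + F'' t / 2 * (t - z) ^ 2| ≤ w r * |z - t| ^ 2 := by
  rcases eq_or_ne z t with rfl | hne
  · simp
  have hr : 0 < r := (abs_pos.2 (sub_ne_zero.2 hne)).trans_le htz
  have hmono : ∀ u, u ∈ uIcc t z → u ≠ t → w |u - t| ≤ w r := fun u hu hut =>
    h.modulus.strictMono.monotoneOn (mem_Ioi.2 (abs_pos.2 (sub_ne_zero.2 hut))) (mem_Ioi.2 hr)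
      ((abs_sub_left_of_mem_uIcc hu).trans htz)
  have h1 : ∀ u ∈ uIcc t z, |F' u - F' t - F'' t * (u - t)| ≤ w r * |u - t| := by
    intro u hu
    have := Convex.norm_image_sub_le_of_norm_hasDerivWithin_le (s := uIcc t z) (C := w r)
      (f := fun u => F' u - F'' t * u) (f' := fun u => F'' u - F'' t) (x := t) (y := u)
      (fun v _ => ((h.hasDerivAt' v).sub
        (by simpa using (hasDerivAt_id v).const_mul (F'' t))).hasDerivWithinAt)
      (fun v hv => ?_) (convex_uIcc _ _) left_mem_uIcc hu
    · rw [Real.norm_eq_abs, Real.norm_eq_abs] at this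
      convert this using 2
      ring
    · rw [Real.norm_eq_abs]
      rcases eq_or_ne v t with rfl | hvt
      · simpa using (h.modulus.pos r hr).le
      · exact (h.holder v t hvt).trans (hmono v hv hvt)
  have := Convex.norm_image_sub_le_of_norm_hasDerivWithin_le (s := uIcc t z) (C := w r * |z - t|)
    (f := fun u => F t - F u - F' t * (t - u) + F'' t / 2 * (t - u) ^ 2)
    (f' := fun u => -(F' u - F' t - F'' t * (u - t))) (x := t) (y := z)
    (fun v _ => ?_)
    (fun v hv => ?_) (convex_uIcc _ _) left_mem_uIcc right_mem_uIcc
  · rw [Real.norm_eq_abs, Real.norm_eq_abs] at this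
    convert this using 1
    · simp
    · ring
  · have e1 := ((h.hasDerivAt v).const_sub (F t))
    have e2 := (((hasDerivAt_id' v).const_sub t).const_mul (F' t))
    have e3 := ((((hasDerivAt_id' v).const_sub t).fun_pow 2).const_mul (F'' t / 2))
    refine (((e1.sub e2).add e3).congr_deriv ?_).hasDerivWithinAt
    simp
    ring
  · rw [Real.norm_eq_abs, abs_neg]
    refine (h1 v hv).trans ?_
    exact mul_le_mul_of_nonneg_left (abs_sub_left_of_mem_uIcc hv) (h.modulus.pos r hr).le

/-- Refined one-step distortion estimate. -/
theorem exists_logSlope_bound (h : IsSmoothLift w F F' F'') :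
    ∃ C, 0 < C ∧ ∀ z u t s r : ℝ, 0 < r → r ≤ 1 → |u - z| ≤ r → t ∈ uIcc z u → s ∈ uIcc z u →
      |(logSlope F z t - Real.log (F' t) / 2) - (logSlope F z s - Real.log (F' s) / 2)|
        ≤ C * w r * |t - s| := by
  obtain ⟨c, b, hc, hb, hbd⟩ := h.exists_bounds
  have hw1 := h.modulus.pos 1 one_pos
  refine ⟨1 / c + b * b / (c * c * w 1), by positivity, fun z u t s r hr hr1 hu ht hs => ?_⟩
  set C := 1 / c + b * b / (c * c * w 1) with hC
  have hderiv : ∀ v ∈ uIcc z u, v ≠ z →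
      HasDerivAt (fun t => logSlope F z t - Real.log (F' t) / 2)
        (F' v / (F v - F z) - 1 / (v - z) - F'' v / F' v / 2) v ∧
      |F' v / (F v - F z) - 1 / (v - z) - F'' v / F' v / 2| ≤ C * w r := by
    intro v hv hvz
    have hvz0 : v - z ≠ 0 := sub_ne_zero.2 hvz
    have hF0 : F v - F z ≠ 0 := sub_ne_zero.2 (h.strictMono.injective.ne hvz)
    constructor
    · have e1 : HasDerivAt (fun t => Real.log (F t - F z) - Real.log (t - z))
          (F' v / (F v - F z) - 1 / (v - z)) v :=
        (((h.hasDerivAt v).sub_const (F z)).log hF0).sub (((hasDerivAt_id' v).sub_const z).log hvz0)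
      have e2 : HasDerivAt (fun t => logSlope F z t)
          (F' v / (F v - F z) - 1 / (v - z)) v := by
        refine e1.congr_of_eventuallyEq ?_
        filter_upwards [isOpen_ne.mem_nhds hvz] with t ht
        rw [logSlope, dslope_of_ne _ ht, slope_def_field, Real.log_div
          (sub_ne_zero.2 (h.strictMono.injective.ne ht)) (sub_ne_zero.2 ht)]
      exact e2.sub (((h.hasDerivAt' v).log (h.pos v).ne').div_const 2)
    · obtain ⟨ξ, hξ, hs⟩ := h.exists_slope v z
      have hvzr : |z - v| ≤ r := by
        rw [abs_sub_comm]; exact (abs_sub_left_of_mem_uIcc hv).trans hu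
      have hT := h.taylor_bound hvzr
      set R := F v - F z - F' v * (v - z) + F'' v / 2 * (v - z) ^ 2 with hR
      have hξ0 := (hbd ξ).1
      have hv0 := (hbd v).1
      have hξp := h.pos ξ
      have hvp := h.pos v
      have heq : F' v / (F v - F z) - 1 / (v - z) - F'' v / F' v / 2 =
          -(R / (v - z) ^ 2) / F' ξ + F'' v / 2 * ((F' v - F' ξ) / (F' ξ * F' v)) := by
        rw [hR, hs]
        field_simp
        ring
      have hlip : |F' v - F' ξ| ≤ b * r := by
        have := Convex.norm_image_sub_le_of_norm_hasDerivWithin_le (s := univ) (C := b)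
          (f := F') (f' := F'') (x := ξ) (y := v)
          (fun t _ => (h.hasDerivAt' t).hasDerivWithinAt)
          (fun t _ => (hbd t).2) convex_univ (mem_univ _) (mem_univ _)
        refine this.trans ?_
        rw [Real.norm_eq_abs, abs_sub_comm]
        gcongr
        exact (abs_sub_left_of_mem_uIcc hξ).trans hvzr
      have hRb : |R / (v - z) ^ 2| ≤ w r := by
        rw [abs_div, abs_of_nonneg (sq_nonneg (v - z)), div_le_iff₀ (by positivity)]
        rwa [sq_abs, ← neg_sub v z, neg_sq] at hT
      have hlin := h.modulus.linear_le hr hr1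
      have hwr := h.modulus.pos r hr
      rw [heq]
      calc _ ≤ |-(R / (v - z) ^ 2) / F' ξ| + |F'' v / 2 * ((F' v - F' ξ) / (F' ξ * F' v))| :=
            abs_add_le _ _
        _ ≤ w r / c + b / 2 * (b * r / (c * c)) := by
            refine add_le_add ?_ ?_
            · rw [abs_div, abs_neg, abs_of_pos hξp]
              gcongr
            · rw [abs_mul, abs_div, abs_div, abs_of_pos (mul_pos hξp hvp), abs_two]
              gcongr
              exact (hbd v).2
        _ ≤ w r / c + b / 2 * (b * (2 * w r / w 1) / (c * c)) := by
            gcongr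
            rwa [le_div_iff₀ hw1]
        _ = C * w r := by rw [hC]; field_simp
  have hcont : Continuous (fun t => logSlope F z t - Real.log (F' t) / 2) := by
    have e1 : Continuous (dslope F z) := by
      refine continuous_iff_continuousAt.2 fun v => ?_
      rcases eq_or_ne v z with rfl | hne
      · exact continuousAt_dslope_same.2 (h.hasDerivAt v).differentiableAt
      · exact (continuousAt_dslope_of_ne hne).2 h.continuous.continuousAt
    exact (e1.log fun t => (h.dslope_pos z t).ne').sub
      ((h.continuous_deriv.log fun t => (h.pos t).ne').div_const 2)
  wlog hts : s < t generalizing s t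
  · rcases eq_or_lt_of_le (not_lt.1 hts) with rfl | hlt
    · simp
    · rw [abs_sub_comm, abs_sub_comm t s]
      exact this s t hs ht hlt
  obtain ⟨ξ, hξ, hslope⟩ := exists_deriv_eq_slope
    (fun t => logSlope F z t - Real.log (F' t) / 2) hts hcont.continuousOn fun v hv =>
      (hderiv v (uIcc_subset_uIcc hs ht (Icc_subset_uIcc (Ioo_subset_Icc_self hv))) (by
        rintro rfl
        rw [mem_uIcc] at hs ht
        rcases hs with hs | hs <;> rcases ht with ht | ht <;>
          linarith [hv.1, hv.2])).1.differentiableAt.differentiableWithinAt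
  have hξz : ξ ≠ z := by
    rintro rfl
    rw [mem_uIcc] at hs ht
    rcases hs with hs | hs <;> rcases ht with ht | ht <;> linarith [hξ.1, hξ.2]
  obtain ⟨e1, e2⟩ :=
    hderiv ξ (uIcc_subset_uIcc hs ht (Icc_subset_uIcc (Ioo_subset_Icc_self hξ))) hξz
  rw [e1.deriv, eq_div_iff (by linarith)] at hslope
  rw [← hslope, abs_mul]
  gcongr

end IsSmoothLift

/-- A smooth lift with irrational rotation number `ρ`, together with the convergents of `ρ`. -/
structure IsIrrationalLift (w F F' F'' : ℝ → ℝ) (ρ : ℝ) (K P Q : ℕ → ℕ) : Prop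
    extends IsSmoothLift w F F' F'', IsConvergents ρ K P Q where
  rotation : ∀ x, Tendsto (fun n : ℕ => (F^[n] x - x) / (n : ℝ)) atTop (𝓝 ρ)

/-- The `n`-th closest return map. -/
def closestReturn (F : ℝ → ℝ) (P Q : ℕ → ℕ) (n : ℕ) (x : ℝ) : ℝ := F^[Q n] x - P n

/-- Displacement of the `n`-th closest return map. -/
def gap (F : ℝ → ℝ) (P Q : ℕ → ℕ) (n : ℕ) (x : ℝ) : ℝ := |closestReturn F P Q n x - x|

namespace IsIrrationalLift

variable {w F F' F'' : ℝ → ℝ} {ρ : ℝ} {K P Q : ℕ → ℕ}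

open IsConvergents

/-- `F` as a bundled lift. -/
def lift (h : IsIrrationalLift w F F' F'' ρ K P Q) : CircleDeg1Lift :=
  ⟨⟨F, h.strictMono.monotone⟩, h.map_add_one⟩

theorem lift_pow_apply (h : IsIrrationalLift w F F' F'' ρ K P Q) (n : ℕ) (x : ℝ) :
    (h.lift ^ n) x = F^[n] x := by
  rw [CircleDeg1Lift.coe_pow]
  rfl

theorem translationNumber_lift_pow (h : IsIrrationalLift w F F' F'' ρ K P Q) (n : ℕ) :
    (h.lift ^ n).translationNumber = n * ρ := by
  rw [CircleDeg1Lift.translationNumber_pow]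
  congr 1
  refine tendsto_nhds_unique (h.lift.tendsto_translationNumber 0) ?_
  simpa only [h.lift_pow_apply] using h.rotation 0

theorem iterate_add_int (h : IsIrrationalLift w F F' F'' ρ K P Q) (i : ℕ) (x : ℝ) (m : ℤ) :
    F^[i] (x + m) = F^[i] x + m := by
  simpa only [h.lift_pow_apply] using (h.lift ^ i).map_add_int x m

theorem iterate_strictMono (h : IsIrrationalLift w F F' F'' ρ K P Q) (i : ℕ) :
    StrictMono F^[i] := h.strictMono.iterate i

theorem iterate_lt_of_lt (h : IsIrrationalLift w F F' F'' ρ K P Q) (a b : ℕ) (c d : ℤ) (x : ℝ)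
    (hlt : a * ρ + c < b * ρ + d) : F^[a] x + c < F^[b] x + d := by
  rcases le_total a b with hab | hab
  · obtain ⟨m, rfl⟩ := Nat.exists_eq_add_of_le hab
    have := (h.lift ^ m).lt_map_of_int_lt_translationNumber (n := c - d) (by
      rw [h.translationNumber_lift_pow]
      push_cast at *
      linarith) (F^[a] x)
    rw [h.lift_pow_apply, ← Function.iterate_add_apply, add_comm m a] at this
    push_cast at this
    linarith
  · obtain ⟨m, rfl⟩ := Nat.exists_eq_add_of_le hab
    have := (h.lift ^ m).map_lt_of_translationNumber_lt_int (n := d - c) (by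
      rw [h.translationNumber_lift_pow]
      push_cast at *
      linarith) (F^[b] x)
    rw [h.lift_pow_apply, ← Function.iterate_add_apply, add_comm m b] at this
    push_cast at this
    linarith

theorem iterate_le_of_le (h : IsIrrationalLift w F F' F'' ρ K P Q) (a b : ℕ) (c d : ℤ) (x : ℝ)
    (hle : a * ρ + c ≤ b * ρ + d) : F^[a] x + c ≤ F^[b] x + d := by
  rcases eq_or_lt_of_le hle with heq | hlt
  · have hab : a = b := by
      by_contra hne
      have h1 : ((a : ℤ) - b : ℤ) ≠ 0 := sub_ne_zero.2 (by exact_mod_cast hne)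
      have h2 := (h.irrational.intCast_mul h1).ne_int (d - c)
      push_cast at h2
      exact h2 (by linarith)
    subst hab
    linarith
  · exact (h.iterate_lt_of_lt a b c d x hlt).le

theorem closestReturn_add_int (h : IsIrrationalLift w F F' F'' ρ K P Q) (n : ℕ) (x : ℝ) (m : ℤ) :
    closestReturn F P Q n (x + m) = closestReturn F P Q n x + m := by
  simp only [closestReturn, h.iterate_add_int]
  ring

theorem closestReturn_iterate (h : IsIrrationalLift w F F' F'' ρ K P Q) (n i : ℕ) (x : ℝ) :
    closestReturn F P Q n (F^[i] x) = F^[i] (closestReturn F P Q n x) := by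
  have := h.iterate_add_int i (F^[Q n] x) (-(P n : ℤ))
  push_cast at this
  rw [closestReturn, closestReturn, sub_eq_add_neg, sub_eq_add_neg, this,
    ← Function.iterate_add_apply, ← Function.iterate_add_apply, add_comm i]

theorem closestReturn_comm (h : IsIrrationalLift w F F' F'' ρ K P Q) (n m : ℕ) (x : ℝ) :
    closestReturn F P Q n (closestReturn F P Q m x) =
      closestReturn F P Q m (closestReturn F P Q n x) := by
  have := h.closestReturn_add_int n (F^[Q m] x) (-(P m : ℤ))
  push_cast at this
  rw [closestReturn.eq_def F P Q m x, sub_eq_add_neg, this, h.closestReturn_iterate]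
  rw [closestReturn.eq_def F P Q m, sub_eq_add_neg]

theorem gap_add_int (h : IsIrrationalLift w F F' F'' ρ K P Q) (n : ℕ) (x : ℝ) (m : ℤ) :
    gap F P Q n (x + m) = gap F P Q n x := by
  rw [gap, gap, h.closestReturn_add_int, add_sub_add_right_eq_sub]

theorem lt_closestReturn (h : IsIrrationalLift w F F' F'' ρ K P Q) {n : ℕ}
    (hn : 0 < err ρ P Q n) (x : ℝ) : x < closestReturn F P Q n x := by
  have := h.iterate_lt_of_lt 0 (Q n) 0 (-(P n : ℤ)) x (by
    rw [err] at hn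
    push_cast
    linarith)
  simpa [closestReturn, sub_eq_add_neg] using this

theorem closestReturn_lt (h : IsIrrationalLift w F F' F'' ρ K P Q) {n : ℕ}
    (hn : err ρ P Q n < 0) (x : ℝ) : closestReturn F P Q n x < x := by
  have := h.iterate_lt_of_lt (Q n) 0 (-(P n : ℤ)) 0 x (by
    rw [err] at hn
    push_cast
    linarith)
  simpa [closestReturn, sub_eq_add_neg] using this

theorem gap_pos (h : IsIrrationalLift w F F' F'' ρ K P Q) (n : ℕ) (x : ℝ) :
    0 < gap F P Q n x := by
  refine abs_pos.2 (sub_ne_zero.2 ?_)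
  rcases lt_or_gt_of_ne (h.err_ne_zero n) with hn | hn
  · exact (h.closestReturn_lt hn x).ne
  · exact (h.lt_closestReturn hn x).ne'

theorem closestReturn_closestReturn (h : IsIrrationalLift w F F' F'' ρ K P Q) (n m : ℕ) (x : ℝ) :
    closestReturn F P Q n (closestReturn F P Q m x) = F^[Q n + Q m] x - P n - P m := by
  have := h.closestReturn_add_int n (F^[Q m] x) (-(P m : ℤ))
  push_cast at this
  rw [closestReturn.eq_def F P Q m x, sub_eq_add_neg, this, closestReturn,
    ← Function.iterate_add_apply]
  ring

/-- Relative position of consecutive closest returns. -/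
theorem closestReturn_order (h : IsIrrationalLift w F F' F'' ρ K P Q) (n : ℕ) (x : ℝ) :
    (x < closestReturn F P Q n x ∧ x < closestReturn F P Q (n + 2) x ∧
      closestReturn F P Q (n + 2) x ≤ closestReturn F P Q (n + 1) (closestReturn F P Q n x) ∧
      closestReturn F P Q (n + 1) (closestReturn F P Q n x) ≤ closestReturn F P Q n x) ∨
    (closestReturn F P Q n x < x ∧ closestReturn F P Q (n + 2) x < x ∧
      closestReturn F P Q (n + 1) (closestReturn F P Q n x) ≤ closestReturn F P Q (n + 2) x ∧
      closestReturn F P Q n x ≤ closestReturn F P Q (n + 1) (closestReturn F P Q n x)) := by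
  have h0 := h.err_mul_neg n
  have h1 := h.err_mul_neg (n + 1)
  have hr := h.err_rec n
  have hK : (1 : ℝ) ≤ K n := by exact_mod_cast h.one_le n
  rw [show n + 1 + 1 = n + 2 by ring] at h1
  rcases lt_or_gt_of_ne (h.err_ne_zero n) with hs | hs
  · right
    have h2 : 0 < err ρ P Q (n + 1) := by nlinarith
    have h3 : err ρ P Q (n + 2) < 0 := by nlinarith
    refine ⟨h.closestReturn_lt hs x, h.closestReturn_lt h3 x, ?_, (h.lt_closestReturn h2 _).le⟩
    have := h.iterate_le_of_le (Q (n + 1) + Q n) (Q (n + 2)) (-(P (n + 1) : ℤ) - P n)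
      (-(P (n + 2) : ℤ)) x (by
        have : err ρ P Q (n + 1) + err ρ P Q n ≤ err ρ P Q (n + 2) := by nlinarith
        simp only [err] at this
        push_cast
        linarith)
    push_cast at this
    rw [h.closestReturn_closestReturn, closestReturn]
    linarith
  · left
    have h2 : err ρ P Q (n + 1) < 0 := by nlinarith
    have h3 : 0 < err ρ P Q (n + 2) := by nlinarith
    refine ⟨h.lt_closestReturn hs x, h.lt_closestReturn h3 x, ?_, (h.closestReturn_lt h2 _).le⟩
    have := h.iterate_le_of_le (Q (n + 2)) (Q (n + 1) + Q n) (-(P (n + 2) : ℤ))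
      (-(P (n + 1) : ℤ) - P n) x (by
        have : err ρ P Q (n + 2) ≤ err ρ P Q (n + 1) + err ρ P Q n := by nlinarith
        simp only [err] at this
        push_cast
        linarith)
    push_cast at this
    rw [h.closestReturn_closestReturn, closestReturn]
    linarith

theorem gap_add_gap_le (h : IsIrrationalLift w F F' F'' ρ K P Q) (n : ℕ) (x : ℝ) :
    gap F P Q (n + 2) x + gap F P Q (n + 1) (closestReturn F P Q n x) ≤ gap F P Q n x := by
  simp only [gap]
  rcases h.closestReturn_order n x with ⟨h0, h1, h2, h3⟩ | ⟨h0, h1, h2, h3⟩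
  · rw [abs_of_pos (by linarith), abs_of_nonpos (by linarith), abs_of_pos (by linarith)]
    linarith
  · rw [abs_of_neg (by linarith), abs_of_nonneg (by linarith), abs_of_neg (by linarith)]
    linarith

theorem closestReturn_mem_uIcc (h : IsIrrationalLift w F F' F'' ρ K P Q) (n : ℕ) (x : ℝ) :
    closestReturn F P Q (n + 2) x ∈ uIcc x (closestReturn F P Q n x) := by
  rw [mem_uIcc]
  rcases h.closestReturn_order n x with ⟨h0, h1, h2, h3⟩ | ⟨h0, h1, h2, h3⟩
  · left; constructor <;> linarith
  · right; constructor <;> linarith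

theorem closestReturn_surjective (h : IsIrrationalLift w F F' F'' ρ K P Q) (n : ℕ) :
    Function.Surjective (closestReturn F P Q n) := fun y => by
  have hs : Function.Surjective F := h.lift.continuous_iff_surjective.1 h.continuous
  obtain ⟨x, hx⟩ := hs.iterate (Q n) (y + P n)
  exact ⟨x, by simp [closestReturn, hx]⟩

theorem gap_iterate (h : IsIrrationalLift w F F' F'' ρ K P Q) (n i : ℕ) (x : ℝ) :
    gap F P Q n (F^[i] x) = |F^[i] (closestReturn F P Q n x) - F^[i] x| := by
  rw [gap, h.closestReturn_iterate]

theorem abs_err_le_abs_sub (h : IsIrrationalLift w F F' F'' ρ K P Q) (n i j : ℕ) (m : ℤ)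
    (hi : i < Q (n + 1)) (hj : j < Q (n + 1)) (hijm : i ≠ j ∨ m ≠ 0) :
    |err ρ P Q n| ≤ |j * ρ + m - i * ρ| := by
  rcases le_total i j with hij | hij
  · obtain ⟨d, rfl⟩ := Nat.exists_eq_add_of_le hij
    convert h.abs_err_le n d (by omega) m (by omega) using 2
    push_cast
    ring
  · obtain ⟨d, rfl⟩ := Nat.exists_eq_add_of_le hij
    rw [abs_sub_comm]
    convert h.abs_err_le n d (by omega) (-m) (by omega) using 2
    push_cast
    ring

/-- The first `Q (n + 1)` iterates of the interval between `x` and its `n`-th closest return are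
pairwise disjoint on the circle. -/
theorem sum_gap_le_one (h : IsIrrationalLift w F F' F'' ρ K P Q) (n : ℕ) (x : ℝ) :
    ∑ i ∈ Finset.range (Q (n + 1)), gap F P Q n (F^[i] x) ≤ 1 := by
  have key : ∀ i j : ℕ, ∀ m : ℤ, |err ρ P Q n| ≤ j * ρ + m - i * ρ →
      max (F^[i] x) (closestReturn F P Q n (F^[i] x)) ≤
        min (F^[j] x) (closestReturn F P Q n (F^[j] x)) + m := by
    intro i j m hm
    rcases lt_or_gt_of_ne (h.err_ne_zero n) with hs | hs
    · rw [max_eq_left (h.closestReturn_lt hs _).le, min_eq_right (h.closestReturn_lt hs _).le]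
      have := h.iterate_le_of_le i (Q n + j) 0 (m - P n) x (by
        rw [abs_of_neg hs, err] at hm
        push_cast
        linarith)
      rw [closestReturn, ← Function.iterate_add_apply]
      push_cast at this
      linarith
    · rw [max_eq_right (h.lt_closestReturn hs _).le, min_eq_left (h.lt_closestReturn hs _).le]
      have := h.iterate_le_of_le (Q n + i) j (-P n) m x (by
        rw [abs_of_pos hs, err] at hm
        push_cast
        linarith)
      rw [closestReturn, ← Function.iterate_add_apply]
      push_cast at this
      linarith
  have := sum_length_le_one_of_disjoint (Q (n + 1))
    (fun i => min (F^[i] x) (closestReturn F P Q n (F^[i] x)))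
    (fun i => max (F^[i] x) (closestReturn F P Q n (F^[i] x)))
    (fun i _ => min_le_max) (fun i hi j hj m hijm => ?_)
  · simpa only [max_sub_min_eq_abs, gap] using this
  · refine Set.disjoint_left.2 fun z hz1 hz2 => ?_
    have h1 := h.abs_err_le_abs_sub n i j m hi hj hijm
    rcases le_abs.1 h1 with h2 | h2
    · have := key i j m h2
      linarith [hz1.2, hz2.1]
    · have := key j i (-m) (by push_cast; linarith)
      push_cast at this
      linarith [hz1.1, hz2.2]

theorem gap_le_one (h : IsIrrationalLift w F F' F'' ρ K P Q) (n : ℕ) (x : ℝ) :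
    gap F P Q n x ≤ 1 :=
  (Finset.single_le_sum (f := fun i => gap F P Q n (F^[i] x))
    (fun i _ => (h.gap_pos n (F^[i] x)).le) (Finset.mem_range.2 (h.Q_pos n))).trans
    (h.sum_gap_le_one n x)

theorem exists_mem_Icc (h : IsIrrationalLift w F F' F'' ρ K P Q) (a b : ℕ) (hab : 0 < Q a + Q b)
    (ha : 0 < err ρ P Q a) (hb : err ρ P Q b < 0) (x ξ : ℝ) :
    (∃ j < Q b, ∃ m : ℤ, ξ ∈ Icc (F^[j] x + m) (closestReturn F P Q a (F^[j] x + m))) ∨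
    (∃ j < Q a, ∃ m : ℤ, ξ ∈ Icc (closestReturn F P Q b (F^[j] x + m)) (F^[j] x + m)) := by
  obtain ⟨j, hj, hmax⟩ := Finset.exists_max_image (Finset.range (Q a + Q b))
    (fun j => F^[j] x + ⌊ξ - F^[j] x⌋) ⟨0, Finset.mem_range.2 hab⟩
  rw [Finset.mem_range] at hj
  have hle : F^[j] x + ⌊ξ - F^[j] x⌋ ≤ ξ := by linarith [Int.floor_le (ξ - F^[j] x)]
  have hmax' : ∀ i < Q a + Q b, ∀ m : ℤ, F^[i] x + m ≤ ξ →
      F^[i] x + m ≤ F^[j] x + ⌊ξ - F^[j] x⌋ := by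
    intro i hi m hm
    refine le_trans ?_ (hmax i (Finset.mem_range.2 hi))
    have : m ≤ ⌊ξ - F^[i] x⌋ := Int.le_floor.2 (by linarith)
    have : (m : ℝ) ≤ ⌊ξ - F^[i] x⌋ := by exact_mod_cast this
    linarith
  set m := ⌊ξ - F^[j] x⌋
  rcases lt_or_ge j (Q b) with hjb | hjb
  · refine Or.inl ⟨j, hjb, m, hle, ?_⟩
    by_contra! hlt
    have h1 := h.lt_closestReturn ha (F^[j] x + m)
    rw [h.closestReturn_add_int, closestReturn, ← Function.iterate_add_apply] at h1 hlt
    have := hmax' (Q a + j) (by omega) (m - P a) (by push_cast; linarith)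
    push_cast at this
    linarith
  · obtain ⟨i, rfl⟩ := Nat.exists_eq_add_of_le hjb
    refine Or.inr ⟨i, by omega, m + P b, ?_, ?_⟩
    · rw [h.closestReturn_add_int, closestReturn, ← Function.iterate_add_apply]
      push_cast
      linarith
    · by_contra! hlt
      have h1 := h.closestReturn_lt hb (F^[i] x + (m + P b : ℤ))
      have h2 := hmax' i (by omega) (m + P b) hlt.le
      rw [h.closestReturn_add_int, closestReturn, ← Function.iterate_add_apply] at h1
      push_cast at h1 h2
      linarith

/-- The intervals of the `n`-th dynamical partition cover the circle. -/
theorem exists_mem_uIcc (h : IsIrrationalLift w F F' F'' ρ K P Q) (n : ℕ) (x ξ : ℝ) :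
    (∃ j < Q (n + 1), ∃ m : ℤ,
      ξ ∈ uIcc (F^[j] x + m) (closestReturn F P Q n (F^[j] x + m))) ∨
    (∃ j < Q n, ∃ m : ℤ,
      ξ ∈ uIcc (F^[j] x + m) (closestReturn F P Q (n + 1) (F^[j] x + m))) := by
  have hQ := h.Q_pos n
  have h0 := h.err_mul_neg n
  rcases lt_or_gt_of_ne (h.err_ne_zero n) with hs | hs
  · have h2 : 0 < err ρ P Q (n + 1) := by nlinarith
    rcases h.exists_mem_Icc (n + 1) n (by omega) h2 hs x ξ with ⟨j, hj, m, hm⟩ | ⟨j, hj, m, hm⟩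
    · exact Or.inr ⟨j, hj, m, Icc_subset_uIcc hm⟩
    · exact Or.inl ⟨j, hj, m, Icc_subset_uIcc' hm⟩
  · have h2 : err ρ P Q (n + 1) < 0 := by nlinarith
    rcases h.exists_mem_Icc n (n + 1) (by omega) hs h2 x ξ with ⟨j, hj, m, hm⟩ | ⟨j, hj, m, hm⟩
    · exact Or.inl ⟨j, hj, m, Icc_subset_uIcc hm⟩
    · exact Or.inr ⟨j, hj, m, Icc_subset_uIcc' hm⟩

end IsIrrationalLift

/-- Logarithm of the derivative of the `m`-th iterate of `F`. -/
noncomputable def logDerivIter (F F' : ℝ → ℝ) (m : ℕ) (x : ℝ) : ℝ :=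
  ∑ i ∈ Finset.range m, Real.log (F' (F^[i] x))

/-- Logarithm of the difference quotient of the `m`-th iterate of `F`. -/
noncomputable def logSlopeIter (F : ℝ → ℝ) (m : ℕ) (x y : ℝ) : ℝ :=
  ∑ i ∈ Finset.range m, IsSmoothLift.logSlope F (F^[i] x) (F^[i] y)

/-- `log F'` is Lipschitz with constant `B`. -/
def LogDerivLipschitz (F' : ℝ → ℝ) (B : ℝ) : Prop :=
  0 < B ∧ ∀ x y, |Real.log (F' x) - Real.log (F' y)| ≤ B * |x - y|

theorem logDerivIter_add (F F' : ℝ → ℝ) (a b : ℕ) (x : ℝ) :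
    logDerivIter F F' (a + b) x = logDerivIter F F' a x + logDerivIter F F' b (F^[a] x) := by
  rw [logDerivIter, Finset.sum_range_add]
  congr 1
  refine Finset.sum_congr rfl fun i _ => ?_
  rw [← Function.iterate_add_apply, add_comm]

theorem logDerivIter_comm (F F' : ℝ → ℝ) (a b : ℕ) (x : ℝ) :
    logDerivIter F F' a (F^[b] x) - logDerivIter F F' a x =
      logDerivIter F F' b (F^[a] x) - logDerivIter F F' b x := by
  have h1 := logDerivIter_add F F' a b x
  rw [add_comm, logDerivIter_add] at h1
  linarith

theorem logSlopeIter_comm (F : ℝ → ℝ) (m : ℕ) (x y : ℝ) :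
    logSlopeIter F m x y = logSlopeIter F m y x :=
  Finset.sum_congr rfl fun _ _ => IsSmoothLift.logSlope_comm _ _

theorem logDerivIter_zero (F F' : ℝ → ℝ) (x : ℝ) : logDerivIter F F' 0 x = 0 := by
  simp [logDerivIter]

namespace IsIrrationalLift

variable {w F F' F'' : ℝ → ℝ} {ρ : ℝ} {K P Q : ℕ → ℕ}

theorem iterate_sub (h : IsIrrationalLift w F F' F'' ρ K P Q) (m : ℕ) (x y : ℝ) :
    F^[m] y - F^[m] x = Real.exp (logSlopeIter F m x y) * (y - x) := by
  induction m with
  | zero => simp [logSlopeIter]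
  | succ m ih =>
    rw [Function.iterate_succ_apply', Function.iterate_succ_apply', h.sub_eq_exp_logSlope, ih,
      logSlopeIter, logSlopeIter, Finset.sum_range_succ, Real.exp_add]
    ring

theorem closestReturn_sub (h : IsIrrationalLift w F F' F'' ρ K P Q) (n : ℕ) (x y : ℝ) :
    closestReturn F P Q n y - closestReturn F P Q n x =
      Real.exp (logSlopeIter F (Q n) x y) * (y - x) := by
  rw [← h.iterate_sub, closestReturn, closestReturn]
  ring

theorem hasDerivAt_iterate (h : IsIrrationalLift w F F' F'' ρ K P Q) (m : ℕ) (x : ℝ) :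
    HasDerivAt F^[m] (Real.exp (logDerivIter F F' m x)) x := by
  induction m with
  | zero => simpa [logDerivIter] using hasDerivAt_id x
  | succ m ih =>
    rw [Function.iterate_succ', logDerivIter, Finset.sum_range_succ, Real.exp_add,
      Real.exp_log (h.pos _), mul_comm]
    exact (h.hasDerivAt _).comp x ih

theorem logDerivIter_add_int (h : IsIrrationalLift w F F' F'' ρ K P Q) (m : ℕ) (x : ℝ) (n : ℤ) :
    logDerivIter F F' m (x + n) = logDerivIter F F' m x := by
  have hp : Function.Periodic F' 1 := h.deriv_add_one
  refine Finset.sum_congr rfl fun i _ => ?_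
  rw [h.iterate_add_int]
  congr 1
  simpa using hp.int_mul n (F^[i] x)

theorem logDerivIter_closestReturn (h : IsIrrationalLift w F F' F'' ρ K P Q) (m n : ℕ) (x : ℝ) :
    logDerivIter F F' m (closestReturn F P Q n x) = logDerivIter F F' m (F^[Q n] x) := by
  have := h.logDerivIter_add_int m (F^[Q n] x) (-(P n : ℤ))
  push_cast at this
  rw [closestReturn, sub_eq_add_neg, this]

theorem logDerivIter_closestReturn_comm (h : IsIrrationalLift w F F' F'' ρ K P Q) (m n : ℕ)
    (x : ℝ) :
    logDerivIter F F' (Q m) (closestReturn F P Q n x) - logDerivIter F F' (Q m) x =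
      logDerivIter F F' (Q n) (closestReturn F P Q m x) - logDerivIter F F' (Q n) x := by
  rw [h.logDerivIter_closestReturn, h.logDerivIter_closestReturn, logDerivIter_comm]

theorem iterate_mem_uIcc (h : IsIrrationalLift w F F' F'' ρ K P Q) (i : ℕ) {x y t : ℝ}
    (ht : t ∈ uIcc x y) : F^[i] t ∈ uIcc (F^[i] x) (F^[i] y) :=
  (h.iterate_strictMono i).monotone.mapsTo_uIcc ht

theorem sum_gap_le_one_of_le (h : IsIrrationalLift w F F' F'' ρ K P Q) {n i : ℕ}
    (hi : i ≤ Q (n + 1)) (x : ℝ) : ∑ j ∈ Finset.range i, gap F P Q n (F^[j] x) ≤ 1 :=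
  (Finset.sum_le_sum_of_subset_of_nonneg (Finset.range_subset_range.2 hi)
    fun _ _ _ => (h.gap_pos n _).le).trans (h.sum_gap_le_one n x)

theorem abs_logDerivIter_sub_le (h : IsIrrationalLift w F F' F'' ρ K P Q) {B : ℝ}
    (hB : LogDerivLipschitz F' B) {n i : ℕ} (hi : i ≤ Q (n + 1)) {x t s : ℝ}
    (ht : t ∈ uIcc x (closestReturn F P Q n x)) (hs : s ∈ uIcc x (closestReturn F P Q n x)) :
    |logDerivIter F F' i t - logDerivIter F F' i s| ≤ B := by
  rw [logDerivIter, logDerivIter, ← Finset.sum_sub_distrib]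
  calc _ ≤ ∑ j ∈ Finset.range i, B * gap F P Q n (F^[j] x) := by
        refine (Finset.abs_sum_le_sum_abs _ _).trans (Finset.sum_le_sum fun j _ => ?_)
        refine (hB.2 _ _).trans (mul_le_mul_of_nonneg_left ?_ hB.1.le)
        rw [h.gap_iterate]
        exact abs_sub_le_of_uIcc_subset_uIcc
          (uIcc_subset_uIcc (h.iterate_mem_uIcc j hs) (h.iterate_mem_uIcc j ht))
    _ ≤ B * 1 := by
        rw [← Finset.mul_sum]
        exact mul_le_mul_of_nonneg_left (h.sum_gap_le_one_of_le hi x) hB.1.le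
    _ = B := mul_one B

theorem abs_logSlopeIter_sub_le (h : IsIrrationalLift w F F' F'' ρ K P Q) {B : ℝ}
    (hB : LogDerivLipschitz F' B) {n i : ℕ} (hi : i ≤ Q (n + 1)) {x t s : ℝ}
    (ht : t ∈ uIcc x (closestReturn F P Q n x)) (hs : s ∈ uIcc x (closestReturn F P Q n x)) :
    |logSlopeIter F i t s - logDerivIter F F' i x| ≤ B := by
  rw [logDerivIter, logSlopeIter, ← Finset.sum_sub_distrib]
  calc _ ≤ ∑ j ∈ Finset.range i, B * gap F P Q n (F^[j] x) := by
        refine (Finset.abs_sum_le_sum_abs _ _).trans (Finset.sum_le_sum fun j _ => ?_)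
        obtain ⟨ξ, h1, h2⟩ := h.exists_logSlope_eq (F^[j] t) (F^[j] s)
        rw [h2]
        refine (hB.2 _ _).trans (mul_le_mul_of_nonneg_left ?_ hB.1.le)
        rw [h.gap_iterate]
        exact abs_sub_left_of_mem_uIcc
          (uIcc_subset_uIcc (h.iterate_mem_uIcc j ht) (h.iterate_mem_uIcc j hs) h1)
    _ ≤ B * 1 := by
        rw [← Finset.mul_sum]
        exact mul_le_mul_of_nonneg_left (h.sum_gap_le_one_of_le hi x) hB.1.le
    _ = B := mul_one B

theorem exists_logDerivIter_eq_zero (h : IsIrrationalLift w F F' F'' ρ K P Q) (m : ℕ) :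
    ∃ ξ, logDerivIter F F' m ξ = 0 := by
  obtain ⟨ξ, -, h1⟩ := exists_hasDerivAt_eq_slope F^[m] _ (zero_lt_one' ℝ)
    (fun t _ => (h.hasDerivAt_iterate m t).continuousAt.continuousWithinAt)
    fun t _ => h.hasDerivAt_iterate m t
  have h2 := h.iterate_add_int m 0 1
  simp only [Int.cast_one, zero_add] at h2
  rw [h2] at h1
  exact ⟨ξ, by simpa using h1⟩

/-- Denjoy's inequality. -/
theorem abs_logDerivIter_le (h : IsIrrationalLift w F F' F'' ρ K P Q) {B : ℝ}
    (hB : LogDerivLipschitz F' B) (n : ℕ) (x : ℝ) : |logDerivIter F F' (Q n) x| ≤ 2 * B := by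
  have hB0 := hB.1
  rcases n with _ | n
  · rw [h.Q_zero, logDerivIter_zero, abs_zero]
    positivity
  obtain ⟨ξ, hξ⟩ := h.exists_logDerivIter_eq_zero (Q (n + 1))
  have hfin : ∀ j : ℕ, j ≤ Q (n + 2) → ∀ m : ℤ,
      |logDerivIter F F' (Q (n + 1)) ξ - logDerivIter F F' (Q (n + 1)) (F^[j] x + m)| ≤ B →
      |logDerivIter F F' (Q (n + 1)) x| ≤ 2 * B := by
    intro j hj m h1
    rw [hξ, h.logDerivIter_add_int] at h1
    have h2 := h.abs_logDerivIter_sub_le hB hj (right_mem_uIcc (a := x)) left_mem_uIcc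
    rw [h.logDerivIter_closestReturn, ← logDerivIter_comm] at h2
    rw [abs_le] at *
    constructor <;> linarith
  rcases h.exists_mem_uIcc n x ξ with ⟨j, hj, m, hm⟩ | ⟨j, hj, m, hm⟩
  · exact hfin j (hj.le.trans (h.Q_le_succ _)) m
      (h.abs_logDerivIter_sub_le hB le_rfl hm left_mem_uIcc)
  · exact hfin j (hj.le.trans (h.Q_mono (by omega))) m
      (h.abs_logDerivIter_sub_le hB (h.Q_le_succ _) hm left_mem_uIcc)

theorem abs_logSlopeIter_le (h : IsIrrationalLift w F F' F'' ρ K P Q) {B : ℝ}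
    (hB : LogDerivLipschitz F' B) {n m : ℕ} (hm : m ≤ n + 1) {x t s : ℝ}
    (ht : t ∈ uIcc x (closestReturn F P Q n x)) (hs : s ∈ uIcc x (closestReturn F P Q n x)) :
    |logSlopeIter F (Q m) t s| ≤ 3 * B := by
  have h1 := h.abs_logSlopeIter_sub_le hB (h.Q_mono hm) ht hs
  have h2 := h.abs_logDerivIter_le hB m x
  rw [abs_le] at *
  constructor <;> linarith

theorem gap_succ_closestReturn_le (h : IsIrrationalLift w F F' F'' ρ K P Q) (n : ℕ) (x : ℝ) :
    gap F P Q (n + 1) (closestReturn F P Q n x) ≤ gap F P Q n x := by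
  linarith [h.gap_add_gap_le n x, h.gap_pos (n + 2) x]

theorem gap_succ_le_mul (h : IsIrrationalLift w F F' F'' ρ K P Q) {B : ℝ}
    (hB : LogDerivLipschitz F' B) (n : ℕ) (x : ℝ) :
    gap F P Q (n + 1) x ≤ Real.exp (3 * B) * gap F P Q (n + 1) (closestReturn F P Q n x) := by
  have h1 : gap F P Q (n + 1) (closestReturn F P Q n x) =
      Real.exp (logSlopeIter F (Q n) x (closestReturn F P Q (n + 1) x)) * gap F P Q (n + 1) x := by
    rw [gap, h.closestReturn_comm, h.closestReturn_sub, abs_mul, Real.abs_exp, gap]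
  have h2 := h.abs_logSlopeIter_le hB (n := n + 1) (m := n) (by omega) (left_mem_uIcc (a := x))
    right_mem_uIcc
  rw [h1, ← mul_assoc, ← Real.exp_add]
  refine le_mul_of_one_le_left (h.gap_pos _ _).le (Real.one_le_exp ?_)
  linarith [(abs_le.1 h2).1]

theorem gap_succ_le (h : IsIrrationalLift w F F' F'' ρ K P Q) {B : ℝ}
    (hB : LogDerivLipschitz F' B) (n : ℕ) (x : ℝ) :
    gap F P Q (n + 1) x ≤ Real.exp (3 * B) * gap F P Q n x :=
  (h.gap_succ_le_mul hB n x).trans (mul_le_mul_of_nonneg_left (h.gap_succ_closestReturn_le n x)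
    (Real.exp_pos _).le)

theorem gap_succ_le_sub (h : IsIrrationalLift w F F' F'' ρ K P Q) {B : ℝ}
    (hB : LogDerivLipschitz F' B) (n : ℕ) (x : ℝ) :
    gap F P Q (n + 1) x ≤ Real.exp (3 * B) * (gap F P Q n x - gap F P Q (n + 2) x) :=
  (h.gap_succ_le_mul hB n x).trans (mul_le_mul_of_nonneg_left
    (by linarith [h.gap_add_gap_le n x]) (Real.exp_pos _).le)

theorem gap_iterate_eq (h : IsIrrationalLift w F F' F'' ρ K P Q) (n i : ℕ) (x : ℝ) :
    gap F P Q n (F^[i] x) =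
      Real.exp (logSlopeIter F i x (closestReturn F P Q n x)) * gap F P Q n x := by
  rw [h.gap_iterate, h.iterate_sub, abs_mul, Real.abs_exp, gap]

theorem gap_iterate_mul_le (h : IsIrrationalLift w F F' F'' ρ K P Q) {B : ℝ}
    (hB : LogDerivLipschitz F' B) {n m i : ℕ} (hn : i ≤ Q (n + 1)) (hm : i ≤ Q (m + 1)) (x : ℝ) :
    gap F P Q m (F^[i] x) * gap F P Q n x ≤
      Real.exp (2 * B) * (gap F P Q n (F^[i] x) * gap F P Q m x) := by
  have h1 := h.abs_logSlopeIter_sub_le hB hn (left_mem_uIcc (a := x)) right_mem_uIcc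
  have h2 := h.abs_logSlopeIter_sub_le hB hm (left_mem_uIcc (a := x)) right_mem_uIcc
  have h3 : Real.exp (logSlopeIter F i x (closestReturn F P Q m x)) ≤
      Real.exp (2 * B) * Real.exp (logSlopeIter F i x (closestReturn F P Q n x)) := by
    rw [← Real.exp_add]
    refine Real.exp_le_exp.2 ?_
    linarith [(abs_le.1 h1).1, (abs_le.1 h2).2]
  have := mul_le_mul_of_nonneg_right h3
    (mul_pos (h.gap_pos m x) (h.gap_pos n x)).le
  rw [h.gap_iterate_eq, h.gap_iterate_eq]
  linarith

/-- Maximal displacement of the `n`-th closest return map. -/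
noncomputable def maxGap (F : ℝ → ℝ) (P Q : ℕ → ℕ) (n : ℕ) : ℝ := ⨆ x, gap F P Q n x

theorem gap_le_maxGap (h : IsIrrationalLift w F F' F'' ρ K P Q) (n : ℕ) (x : ℝ) :
    gap F P Q n x ≤ maxGap F P Q n :=
  le_ciSup (f := gap F P Q n) ⟨1, by rintro _ ⟨y, rfl⟩; exact h.gap_le_one n y⟩ x

theorem maxGap_pos (h : IsIrrationalLift w F F' F'' ρ K P Q) (n : ℕ) : 0 < maxGap F P Q n :=
  (h.gap_pos n 0).trans_le (h.gap_le_maxGap n 0)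

theorem maxGap_le_one (h : IsIrrationalLift w F F' F'' ρ K P Q) (n : ℕ) : maxGap F P Q n ≤ 1 :=
  ciSup_le (h.gap_le_one n)

theorem gap_succ_le_maxGap (h : IsIrrationalLift w F F' F'' ρ K P Q) (n : ℕ) (x : ℝ) :
    gap F P Q (n + 1) x ≤ maxGap F P Q n := by
  obtain ⟨y, rfl⟩ := h.closestReturn_surjective n x
  exact (h.gap_succ_closestReturn_le n y).trans (h.gap_le_maxGap n y)

theorem gap_le_of_mem_uIcc (h : IsIrrationalLift w F F' F'' ρ K P Q) {B : ℝ}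
    (hB : LogDerivLipschitz F' B) {n m : ℕ} (hnm : n ≤ m) (hmn : m ≤ n + 1) {a ξ : ℝ}
    (hξ : ξ ∈ uIcc a (closestReturn F P Q m a)) :
    gap F P Q n ξ ≤ (Real.exp (3 * B) + 1) ^ 2 * gap F P Q n a := by
  have h1 : |ξ - a| ≤ gap F P Q m a := abs_sub_left_of_mem_uIcc hξ
  have h2 := h.abs_logSlopeIter_le hB (m := n) (by omega) (left_mem_uIcc (a := a)) hξ
  have he : 1 ≤ Real.exp (3 * B) := Real.one_le_exp (by linarith [hB.1])
  have hgm : gap F P Q m a ≤ Real.exp (3 * B) * gap F P Q n a := by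
    rcases (by omega : m = n ∨ m = n + 1) with rfl | rfl
    · exact le_mul_of_one_le_left (h.gap_pos _ _).le he
    · exact h.gap_succ_le hB n a
  have h3 : gap F P Q n ξ ≤ Real.exp (3 * B) * |ξ - a| + gap F P Q n a + |ξ - a| := by
    have h4 : closestReturn F P Q n ξ - ξ = (closestReturn F P Q n ξ - closestReturn F P Q n a)
      + (closestReturn F P Q n a - a) + (a - ξ) := by ring
    rw [gap, h4]
    refine (abs_add_three _ _ _).trans ?_
    rw [h.closestReturn_sub, abs_mul, Real.abs_exp, abs_sub_comm a ξ, gap]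
    gcongr
    exact (abs_le.1 h2).2
  have h5 := h.gap_pos n a
  nlinarith [mul_le_mul_of_nonneg_left (h1.trans hgm) (by linarith : 0 ≤ Real.exp (3 * B) + 1)]

/-- Ratios of displacements at a point are controlled by the ratios of maximal displacements. -/
theorem gap_mul_maxGap_le (h : IsIrrationalLift w F F' F'' ρ K P Q) {B : ℝ}
    (hB : LogDerivLipschitz F' B) {n i : ℕ} (hi : i ≤ n) (x : ℝ) :
    gap F P Q n x * maxGap F P Q i ≤
      2 * Real.exp (2 * B) * (Real.exp (3 * B) + 1) ^ 2 * (maxGap F P Q n * gap F P Q i x) := by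
  have hL := h.maxGap_pos i
  obtain ⟨ξ, hξ⟩ := exists_lt_of_lt_ciSup (f := gap F P Q i) (half_lt_self hL)
  have hfin : ∀ j : ℕ, j ≤ Q (i + 1) → ∀ m : ℤ,
      gap F P Q i ξ ≤ (Real.exp (3 * B) + 1) ^ 2 * gap F P Q i (F^[j] x + m) →
      gap F P Q n x * maxGap F P Q i ≤
      2 * Real.exp (2 * B) * (Real.exp (3 * B) + 1) ^ 2 * (maxGap F P Q n * gap F P Q i x) := by
    intro j hj m h1
    rw [h.gap_add_int] at h1
    have h2 := h.gap_iterate_mul_le hB (n := n) (hj.trans (h.Q_mono (by omega))) hj x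
    have h3 := h.gap_le_maxGap n (F^[j] x)
    have h4 := h.gap_pos i x
    have h5 := h.gap_pos n x
    calc gap F P Q n x * maxGap F P Q i ≤
          gap F P Q n x * (2 * ((Real.exp (3 * B) + 1) ^ 2 * gap F P Q i (F^[j] x))) := by
            have hξ' : maxGap F P Q i / 2 < gap F P Q i ξ := hξ
            exact mul_le_mul_of_nonneg_left (by linarith) h5.le
      _ = 2 * (Real.exp (3 * B) + 1) ^ 2 * (gap F P Q i (F^[j] x) * gap F P Q n x) := by ring
      _ ≤ 2 * (Real.exp (3 * B) + 1) ^ 2 *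
          (Real.exp (2 * B) * (maxGap F P Q n * gap F P Q i x)) := by
            exact mul_le_mul_of_nonneg_left (h2.trans (mul_le_mul_of_nonneg_left
              (mul_le_mul_of_nonneg_right h3 h4.le) (Real.exp_pos _).le)) (by positivity)
      _ = _ := by ring
  rcases h.exists_mem_uIcc i x ξ with ⟨j, hj, m, hm⟩ | ⟨j, hj, m, hm⟩
  · exact hfin j hj.le m (h.gap_le_of_mem_uIcc hB le_rfl (by omega) hm)
  · exact hfin j (hj.le.trans (h.Q_le_succ _)) m (h.gap_le_of_mem_uIcc hB (by omega) le_rfl hm)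

end IsIrrationalLift

theorem abs_exp_sub_exp_le {a b M : ℝ} (ha : a ≤ M) (hb : b ≤ M) :
    |Real.exp a - Real.exp b| ≤ Real.exp M * |a - b| := by
  have := Convex.norm_image_sub_le_of_norm_hasDerivWithin_le (s := Iic M) (C := Real.exp M)
    (f := Real.exp) (f' := Real.exp) (x := b) (y := a)
    (fun t _ => (Real.hasDerivAt_exp t).hasDerivWithinAt)
    (fun t ht => by simpa using ht) (convex_Iic M) hb ha
  simpa using this

theorem abs_le_exp_mul_abs_exp_sub_one {a M : ℝ} (ha : |a| ≤ M) :
    |a| ≤ Real.exp M * |Real.exp a - 1| := by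
  have hM : 0 ≤ M := (abs_nonneg a).trans ha
  rcases le_total 0 a with h0 | h0
  · have h1 := Real.add_one_le_exp a
    have h2 := Real.one_le_exp hM
    rw [abs_of_nonneg h0, abs_of_nonneg (by linarith)]
    nlinarith
  · have h1 := Real.add_one_le_exp (-a)
    have h2 := Real.exp_le_one_iff.2 h0
    have h3 : Real.exp (-a) ≤ Real.exp M := Real.exp_le_exp.2 (by rwa [abs_of_nonpos h0] at ha)
    have h4 : Real.exp (-a) * Real.exp a = 1 := by rw [← Real.exp_add]; simp
    rw [abs_of_nonpos h0, abs_of_nonpos (by linarith)]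
    nlinarith

/-- A pair of coupled linear recursive inequalities along a summable-gap sequence. -/
theorem le_mul_sum_of_recursion {c M : ℝ} (hc : 0 ≤ c) (hM : 0 ≤ M) {δ t e W : ℕ → ℝ}
    (hδ : ∀ n, 0 < δ n) (hδ1 : ∀ n, δ (n + 1) ≤ c * δ n)
    (hδ2 : ∀ n, δ (n + 1) ≤ c * (δ n - δ (n + 2))) (ht : ∀ n, 0 ≤ t n) (hW : ∀ n, 0 ≤ W n)
    (ht0 : t 0 = 0) (he0 : e 0 = 0)
    (hts : ∀ n, t (n + 1) ≤ δ (n + 2) / δ n * t n + M * W n * (δ (n + 2) / δ (n + 1)))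
    (hes : ∀ n, e (n + 1) ≤ δ (n + 1) / δ n * e n + M * (t n + W n)) (n : ℕ) :
    e n ≤ (M + M ^ 2 * (1 + c + c ^ 2)) * ∑ j ∈ Finset.range n, δ n / δ (j + 1) * W j := by
  have key : ∀ n, e n / δ n + M * (t n / (δ (n + 1) * δ n)) * (δ n + c * (δ n + δ (n + 1))) ≤
      (M + M ^ 2 * (1 + c + c ^ 2)) * ∑ j ∈ Finset.range n, W j / δ (j + 1) := by
    intro n
    induction n with
    | zero => simp [ht0, he0]
    | succ n ih =>
      rw [Finset.sum_range_succ, mul_add]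
      have d0 := hδ n
      have d1 := hδ (n + 1)
      have d2 := hδ (n + 2)
      have hT : t (n + 1) / (δ (n + 2) * δ (n + 1)) ≤
          t n / (δ (n + 1) * δ n) + M * (W n / δ (n + 1)) / δ (n + 1) := by
        rw [div_le_iff₀ (by positivity)]
        refine (hts n).trans_eq ?_
        field_simp
      have hE : e (n + 1) / δ (n + 1) ≤
          e n / δ n + M * (t n / (δ (n + 1) * δ n)) * δ n + M * (W n / δ (n + 1)) := by
        rw [div_le_iff₀ (by positivity)]
        refine (hes n).trans_eq ?_
        field_simp
        ring
      set T := t n / (δ (n + 1) * δ n) with hTd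
      set V := W n / δ (n + 1) with hVd
      have hT0 : 0 ≤ T := div_nonneg (ht n) (by positivity)
      have hV0 : 0 ≤ V := div_nonneg (hW n) d1.le
      set r := δ (n + 1) + c * (δ (n + 1) + δ (n + 2)) with hr
      have hr0 : 0 ≤ r := by positivity
      have hrr : r / δ (n + 1) ≤ 1 + c + c ^ 2 := by
        rw [div_le_iff₀ d1]
        nlinarith [hδ1 (n + 1)]
      have h1 : M * (t (n + 1) / (δ (n + 2) * δ (n + 1))) * r ≤
          M * (T + M * V / δ (n + 1)) * r := by gcongr
      have h2 : M * (T + M * V / δ (n + 1)) * r = M * T * r + M ^ 2 * V * (r / δ (n + 1)) := by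
        field_simp
      have h3 : M ^ 2 * V * (r / δ (n + 1)) ≤ M ^ 2 * V * (1 + c + c ^ 2) := by gcongr
      have h4 : M * T * r ≤ M * T * (c * (δ n + δ (n + 1))) := by
        refine mul_le_mul_of_nonneg_left ?_ (by positivity)
        linarith [hδ2 n]
      nlinarith
  have h1 := key n
  have d0 := hδ n
  have d1 := hδ (n + 1)
  have h2 : 0 ≤ M * (t n / (δ (n + 1) * δ n)) * (δ n + c * (δ n + δ (n + 1))) := by
    have := ht n
    positivity
  have h3 : e n / δ n ≤ (M + M ^ 2 * (1 + c + c ^ 2)) * ∑ j ∈ Finset.range n, W j / δ (j + 1) := by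
    linarith
  rw [div_le_iff₀ d0] at h3
  refine h3.trans_eq ?_
  rw [mul_assoc, Finset.sum_mul]
  congr 1
  exact Finset.sum_congr rfl fun j _ => by ring

/-- Second-order control of the logarithmic slopes of `F` at scale `r` by `w r`. -/
def LogSlopeBound (w F F' : ℝ → ℝ) (C : ℝ) : Prop :=
  0 < C ∧ ∀ z u t s r : ℝ, 0 < r → r ≤ 1 → |u - z| ≤ r → t ∈ uIcc z u → s ∈ uIcc z u →
    |(IsSmoothLift.logSlope F z t - Real.log (F' t) / 2) -
      (IsSmoothLift.logSlope F z s - Real.log (F' s) / 2)| ≤ C * w r * |t - s|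

/-- Increment of `log (F^[Q (n + 1)])'` along the `n`-th closest return. -/
noncomputable def logDerivIncr (F F' : ℝ → ℝ) (P Q : ℕ → ℕ) (n : ℕ) (x : ℝ) : ℝ :=
  logDerivIter F F' (Q (n + 1)) (closestReturn F P Q n x) - logDerivIter F F' (Q (n + 1)) x

namespace IsIrrationalLift

variable {w F F' F'' : ℝ → ℝ} {ρ : ℝ} {K P Q : ℕ → ℕ}

theorem logSlopeIter_self (h : IsIrrationalLift w F F' F'' ρ K P Q) (m : ℕ) (x : ℝ) :
    logSlopeIter F m x x = logDerivIter F F' m x :=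
  Finset.sum_congr rfl fun _ _ => h.logSlope_self _

theorem abs_logSlopeIter_sub_sub_le (h : IsIrrationalLift w F F' F'' ρ K P Q) {C : ℝ}
    (hC : LogSlopeBound w F F' C) {m : ℕ} {z u t s r : ℝ} (hr : 0 < r) (hr1 : r ≤ 1)
    (hu : ∀ j < m, |F^[j] u - F^[j] z| ≤ r) (ht : t ∈ uIcc z u) (hs : s ∈ uIcc z u) :
    |(logSlopeIter F m z t - logDerivIter F F' m t / 2) -
      (logSlopeIter F m z s - logDerivIter F F' m s / 2)| ≤
      C * w r * ∑ j ∈ Finset.range m, |F^[j] t - F^[j] s| := by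
  simp only [logSlopeIter, logDerivIter, Finset.sum_div, ← Finset.sum_sub_distrib, Finset.mul_sum]
  exact (Finset.abs_sum_le_sum_abs _ _).trans (Finset.sum_le_sum fun j hj =>
    hC.2 _ _ _ _ _ hr hr1 (hu j (Finset.mem_range.1 hj)) (h.iterate_mem_uIcc j ht)
      (h.iterate_mem_uIcc j hs))

theorem abs_logSlopeIter_sub_half_le (h : IsIrrationalLift w F F' F'' ρ K P Q) {C : ℝ}
    (hC : LogSlopeBound w F F' C) {m : ℕ} {z u t r : ℝ} (hr : 0 < r) (hr1 : r ≤ 1)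
    (hu : ∀ j < m, |F^[j] u - F^[j] z| ≤ r)
    (hsum : ∑ j ∈ Finset.range m, |F^[j] u - F^[j] z| ≤ 1) (ht : t ∈ uIcc z u) :
    |logSlopeIter F m z t - (logDerivIter F F' m z + logDerivIter F F' m t) / 2| ≤ C * w r := by
  have h1 := h.abs_logSlopeIter_sub_sub_le hC hr hr1 hu ht left_mem_uIcc
  rw [h.logSlopeIter_self] at h1
  have h2 : ∑ j ∈ Finset.range m, |F^[j] t - F^[j] z| ≤ 1 :=
    (Finset.sum_le_sum fun j _ => abs_sub_left_of_mem_uIcc (h.iterate_mem_uIcc j ht)).trans hsum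
  have h3 : 0 ≤ C * w r := mul_nonneg hC.1.le (h.modulus.pos r hr).le
  refine le_trans (le_of_eq ?_) (h1.trans (mul_le_of_le_one_right h3 h2))
  congr 1
  ring

theorem abs_logDerivIncr_le (h : IsIrrationalLift w F F' F'' ρ K P Q) {B : ℝ}
    (hB : LogDerivLipschitz F' B) (n : ℕ) (x : ℝ) : |logDerivIncr F F' P Q n x| ≤ B :=
  h.abs_logDerivIter_sub_le hB le_rfl right_mem_uIcc left_mem_uIcc

theorem logDerivIncr_eq (h : IsIrrationalLift w F F' F'' ρ K P Q) (n : ℕ) (x : ℝ) :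
    logDerivIncr F F' P Q n x =
      logDerivIter F F' (Q n) (closestReturn F P Q (n + 1) x) - logDerivIter F F' (Q n) x :=
  h.logDerivIter_closestReturn_comm _ _ _

theorem logDerivIncr_zero (h : IsIrrationalLift w F F' F'' ρ K P Q) (x : ℝ) :
    logDerivIncr F F' P Q 0 x = 0 := by
  rw [h.logDerivIncr_eq, h.Q_zero, logDerivIter_zero, logDerivIter_zero, sub_self]

theorem sum_gap_add_two_le (h : IsIrrationalLift w F F' F'' ρ K P Q) {B : ℝ}
    (hB : LogDerivLipschitz F' B) (n : ℕ) (x : ℝ) :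
    ∑ j ∈ Finset.range (Q (n + 1)), gap F P Q (n + 2) (F^[j] x) ≤
      Real.exp (2 * B) * (gap F P Q (n + 2) x / gap F P Q (n + 1) x) := by
  have h1 := h.gap_pos (n + 1) x
  have h2 := h.gap_pos (n + 2) x
  calc _ ≤ ∑ j ∈ Finset.range (Q (n + 1)),
        Real.exp (2 * B) * (gap F P Q (n + 2) x / gap F P Q (n + 1) x) *
          gap F P Q (n + 1) (F^[j] x) := by
        refine Finset.sum_le_sum fun j hj => ?_
        have hj' := (Finset.mem_range.1 hj).le
        have h3 := h.gap_iterate_mul_le hB (n := n + 1) (m := n + 2)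
          (hj'.trans (h.Q_mono (by omega))) (hj'.trans (h.Q_mono (by omega))) x
        rw [← le_div_iff₀ h1] at h3
        refine h3.trans_eq ?_
        field_simp
    _ ≤ _ := by
        rw [← Finset.mul_sum]
        exact mul_le_of_le_one_right (by positivity)
          (h.sum_gap_le_one_of_le (h.Q_mono (by omega)) x)

theorem abs_iterate_closestReturn_sub_le (h : IsIrrationalLift w F F' F'' ρ K P Q) (n j : ℕ)
    (x : ℝ) : |F^[j] (closestReturn F P Q n x) - F^[j] x| ≤ maxGap F P Q n := by
  rw [← h.gap_iterate]
  exact h.gap_le_maxGap n _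

theorem sum_abs_iterate_closestReturn_sub_le (h : IsIrrationalLift w F F' F'' ρ K P Q) {n i : ℕ}
    (hi : i ≤ Q (n + 1)) (x : ℝ) :
    ∑ j ∈ Finset.range i, |F^[j] (closestReturn F P Q n x) - F^[j] x| ≤ 1 := by
  simpa only [h.gap_iterate] using h.sum_gap_le_one_of_le hi x

theorem exp_logDerivIncr_succ_le (h : IsIrrationalLift w F F' F'' ρ K P Q) {B C : ℝ}
    (hB : LogDerivLipschitz F' B) (hC : LogSlopeBound w F F' C) (n : ℕ) (x : ℝ) :
    |Real.exp (-(logDerivIncr F F' P Q (n + 1) x) / 2) - 1| ≤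
      gap F P Q (n + 2) x / gap F P Q n x *
        |Real.exp (-(logDerivIncr F F' P Q n x) / 2) - 1| +
      Real.exp (6 * B) * C * (2 * Real.exp (3 * B) + Real.exp (2 * B)) * w (maxGap F P Q n) *
        (gap F P Q (n + 2) x / gap F P Q (n + 1) x) := by
  have hB0 := hB.1
  have hC0 := hC.1
  have hW := h.modulus.pos _ (h.maxGap_pos n)
  have d0 := h.gap_pos n x
  have d1 := h.gap_pos (n + 1) x
  have d2 := h.gap_pos (n + 2) x
  have hd := h.gap_succ_le hB n x
  have hr := h.maxGap_pos n
  have hr1 := h.maxGap_le_one n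
  have hy := h.closestReturn_mem_uIcc n x
  have hsum := h.sum_gap_add_two_le hB n x
  have hS' := h.abs_logDerivIncr_le hB (n + 1) x
  have hu : ∀ j < Q (n + 1), |F^[j] (closestReturn F P Q n x) - F^[j] x| ≤ maxGap F P Q n :=
    fun j _ => h.abs_iterate_closestReturn_sub_le n j x
  have hsn := h.sum_abs_iterate_closestReturn_sub_le (le_refl (Q (n + 1))) x
  have hdz : gap F P Q n x = |closestReturn F P Q n x - x| := rfl
  have hdy : gap F P Q (n + 2) x = |closestReturn F P Q (n + 2) x - x| := rfl
  have hA1 := h.abs_logSlopeIter_le hB (m := n + 1) le_rfl left_mem_uIcc hy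
  have hA2 := h.abs_logSlopeIter_le hB (m := n + 1) le_rfl (left_mem_uIcc (a := x)) right_mem_uIcc
  have hA3 := h.abs_logSlopeIter_le hB (m := n + 1) le_rfl hy right_mem_uIcc
  have hS := h.abs_logDerivIncr_le hB n x
  rw [h.logDerivIncr_eq (n + 1) x] at hS' ⊢
  rw [logDerivIncr] at hS ⊢
  simp only [gap_iterate h, show n + 1 + 1 = n + 2 from rfl] at hsum hS' ⊢
  generalize closestReturn F P Q n x = z at *
  generalize closestReturn F P Q (n + 2) x = y at *
  have hu' : ∀ j < Q (n + 1), |F^[j] x - F^[j] z| ≤ maxGap F P Q n := fun j hj => by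
    rw [abs_sub_comm]; exact hu j hj
  have hsn' : ∑ j ∈ Finset.range (Q (n + 1)), |F^[j] x - F^[j] z| ≤ 1 := by
    simpa only [abs_sub_comm] using hsn
  have e1 := h.abs_logSlopeIter_sub_half_le hC hr hr1 hu hsn hy
  have e3 := h.abs_logSlopeIter_sub_half_le hC hr hr1 hu' hsn' (by rwa [uIcc_comm])
  have e23 := h.abs_logSlopeIter_sub_sub_le hC hr hr1 hu' (t := x) (s := y) right_mem_uIcc
    (by rwa [uIcc_comm])
  have i1 := h.iterate_sub (Q (n + 1)) x y
  have i2 := h.iterate_sub (Q (n + 1)) x z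
  have i3 := h.iterate_sub (Q (n + 1)) y z
  rw [logSlopeIter_comm F _ z x, logSlopeIter_comm F _ z y] at e23
  rw [logSlopeIter_comm F _ z y] at e3
  simp only [abs_sub_comm (F^[_] x)] at e23
  generalize ∑ j ∈ Finset.range (Q (n + 1)), |F^[j] y - F^[j] x| = σ at *
  generalize logSlopeIter F (Q (n + 1)) x y = A1 at *
  generalize logSlopeIter F (Q (n + 1)) x z = A2 at *
  generalize logSlopeIter F (Q (n + 1)) y z = A3 at *
  generalize logDerivIter F F' (Q (n + 1)) x = a at *
  generalize logDerivIter F F' (Q (n + 1)) y = b at *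
  generalize logDerivIter F F' (Q (n + 1)) z = c at *
  generalize w (maxGap F P Q n) = W at *
  generalize gap F P Q n x = δ0 at *
  generalize gap F P Q (n + 1) x = δ1 at *
  generalize gap F P Q (n + 2) x = δ2 at *
  have key : δ0 * |Real.exp (A2 - A3) - 1| = δ2 * |Real.exp (A1 - A3) - 1| := by
    rw [hdz, hdy, ← abs_mul, ← abs_mul, Real.exp_sub, Real.exp_sub]
    congr 1
    field_simp
    linarith
  rw [abs_le] at hA1 hA2 hA3 hS hS'
  have f1 : |Real.exp (-(b - a) / 2) - Real.exp (A2 - A3)| ≤ Real.exp (6 * B) * (C * W * σ) := by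
    refine (abs_exp_sub_exp_le (M := 6 * B) (by linarith) (by linarith)).trans ?_
    refine mul_le_mul_of_nonneg_left (le_trans (le_of_eq ?_) e23) (Real.exp_pos _).le
    rw [abs_sub_comm]
    congr 1
    ring
  have f2 : |Real.exp (A1 - A3) - Real.exp (-(c - a) / 2)| ≤ Real.exp (6 * B) * (2 * (C * W)) := by
    refine (abs_exp_sub_exp_le (M := 6 * B) (by linarith) (by linarith)).trans ?_
    refine mul_le_mul_of_nonneg_left ?_ (Real.exp_pos _).le
    rw [abs_le] at *
    constructor <;> linarith
  have g1 : |Real.exp (-(b - a) / 2) - 1| ≤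
      Real.exp (6 * B) * (C * W * σ) + |Real.exp (A2 - A3) - 1| :=
    (abs_sub_le _ _ _).trans (by gcongr)
  have g2 : |Real.exp (A1 - A3) - 1| ≤
      Real.exp (6 * B) * (2 * (C * W)) + |Real.exp (-(c - a) / 2) - 1| :=
    (abs_sub_le _ _ _).trans (by gcongr)
  have g3 : |Real.exp (A2 - A3) - 1| = δ2 / δ0 * |Real.exp (A1 - A3) - 1| := by
    field_simp
    linarith
  have g4 : δ2 / δ0 ≤ Real.exp (3 * B) * (δ2 / δ1) := by
    rw [← mul_div_assoc, div_le_div_iff₀ d0 d1]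
    nlinarith
  calc _ ≤ Real.exp (6 * B) * (C * W * (Real.exp (2 * B) * (δ2 / δ1))) + δ2 / δ0 *
        (Real.exp (6 * B) * (2 * (C * W)) + |Real.exp (-(c - a) / 2) - 1|) := by
        rw [g3] at g1
        exact g1.trans (by gcongr)
    _ = Real.exp (6 * B) * (C * W * (Real.exp (2 * B) * (δ2 / δ1))) + δ2 / δ0 *
        (Real.exp (6 * B) * (2 * (C * W))) + δ2 / δ0 * |Real.exp (-(c - a) / 2) - 1| := by ring
    _ ≤ Real.exp (6 * B) * (C * W * (Real.exp (2 * B) * (δ2 / δ1))) +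
        Real.exp (3 * B) * (δ2 / δ1) *
        (Real.exp (6 * B) * (2 * (C * W))) + δ2 / δ0 * |Real.exp (-(c - a) / 2) - 1| := by gcongr
    _ = _ := by ring

theorem exp_logDerivIter_succ_le (h : IsIrrationalLift w F F' F'' ρ K P Q) {B C : ℝ}
    (hB : LogDerivLipschitz F' B) (hC : LogSlopeBound w F F' C) (n : ℕ) (x : ℝ) :
    |Real.exp (logDerivIter F F' (Q (n + 1)) x) - 1| ≤
      gap F P Q (n + 1) x / gap F P Q n x * |Real.exp (logDerivIter F F' (Q n) x) - 1| +
      Real.exp (3 * B) * (Real.exp (3 * B) + 1) * (Real.exp B + C) *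
        (|Real.exp (-(logDerivIncr F F' P Q n x) / 2) - 1| + w (maxGap F P Q n)) := by
  have hB0 := hB.1
  have hC0 := hC.1
  have hW := h.modulus.pos _ (h.maxGap_pos n)
  have d0 := h.gap_pos n x
  have d1 := h.gap_pos (n + 1) x
  have hd := h.gap_succ_le hB n x
  have hr := h.maxGap_pos n
  have hr1 := h.maxGap_le_one n
  have hS := h.abs_logDerivIncr_le hB n x
  have hSn := h.logDerivIncr_eq n x
  have hdz : gap F P Q n x = |closestReturn F P Q n x - x| := rfl
  have hdy : gap F P Q (n + 1) x = |closestReturn F P Q (n + 1) x - x| := rfl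
  have e1 := h.abs_logSlopeIter_sub_half_le hC hr hr1 (m := Q (n + 1))
    (fun j _ => h.abs_iterate_closestReturn_sub_le n j x)
    (h.sum_abs_iterate_closestReturn_sub_le le_rfl x) right_mem_uIcc
  have e2 := h.abs_logSlopeIter_sub_half_le hC hr hr1 (m := Q n)
    (u := closestReturn F P Q (n + 1) x) (z := x)
    (fun j _ => by rw [← h.gap_iterate]; exact h.gap_succ_le_maxGap n _)
    (h.sum_abs_iterate_closestReturn_sub_le (h.Q_mono (by omega)) x) right_mem_uIcc
  have i1 := h.closestReturn_sub (n + 1) x (closestReturn F P Q n x)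
  have i2 := h.closestReturn_sub n x (closestReturn F P Q (n + 1) x)
  rw [h.closestReturn_comm] at i1
  have hA1 := h.abs_logSlopeIter_le hB (m := n + 1) le_rfl (left_mem_uIcc (a := x)) right_mem_uIcc
  have hA2 := h.abs_logSlopeIter_le hB (n := n + 1) (m := n) (by omega) (left_mem_uIcc (a := x))
    right_mem_uIcc
  have hD1 := h.abs_logDerivIter_le hB (n + 1) x
  have hD2 := h.abs_logDerivIter_le hB n x
  have hS1 := abs_le_exp_mul_abs_exp_sub_one (a := -(logDerivIncr F F' P Q n x) / 2) (M := B) (by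
    rw [abs_div, abs_neg, abs_two]
    linarith)
  have hSn' : logDerivIncr F F' P Q n x = logDerivIter F F' (Q (n + 1)) (closestReturn F P Q n x) -
    logDerivIter F F' (Q (n + 1)) x := rfl
  generalize logDerivIncr F F' P Q n x = S at *
  generalize closestReturn F P Q n (closestReturn F P Q (n + 1) x) = v at *
  generalize closestReturn F P Q n x = z at *
  generalize closestReturn F P Q (n + 1) x = y at *
  generalize logSlopeIter F (Q (n + 1)) x z = A1 at *
  generalize logSlopeIter F (Q n) x y = A2 at *
  generalize logDerivIter F F' (Q (n + 1)) x = a at *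
  generalize logDerivIter F F' (Q n) x = b at *
  generalize w (maxGap F P Q n) = W at *
  generalize gap F P Q n x = δ0 at *
  generalize gap F P Q (n + 1) x = δ1 at *
  have key : δ0 * |Real.exp A1 - 1| = δ1 * |Real.exp A2 - 1| := by
    rw [hdz, hdy, ← abs_mul, ← abs_mul]
    congr 1
    linarith
  generalize |Real.exp (-S / 2) - 1| = t at *
  have hS1' : |S| / 2 ≤ Real.exp B * t := by
    rwa [abs_div, abs_neg, abs_two] at hS1
  rw [abs_le] at hA1 hA2 hD1 hD2
  have ht : 0 ≤ t := by
    have h1 := abs_nonneg S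
    have h2 : 0 ≤ Real.exp B * t := by linarith
    exact nonneg_of_mul_nonneg_right h2 (Real.exp_pos _)
  have hbd : Real.exp B * t + C * W ≤ (Real.exp B + C) * (t + W) := by
    nlinarith [mul_nonneg hC0.le ht, mul_pos (Real.exp_pos B) hW]
  have s1 := le_abs_self S
  have s2 := neg_abs_le S
  have f1 : |Real.exp a - Real.exp A1| ≤ Real.exp (3 * B) * ((Real.exp B + C) * (t + W)) := by
    refine (abs_exp_sub_exp_le (M := 3 * B) (by linarith) (by linarith)).trans ?_
    refine mul_le_mul_of_nonneg_left (le_trans ?_ hbd) (Real.exp_pos _).le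
    rw [abs_le] at *
    constructor <;> linarith
  have f2 : |Real.exp A2 - Real.exp b| ≤ Real.exp (3 * B) * ((Real.exp B + C) * (t + W)) := by
    refine (abs_exp_sub_exp_le (M := 3 * B) (by linarith) (by linarith)).trans ?_
    refine mul_le_mul_of_nonneg_left (le_trans ?_ hbd) (Real.exp_pos _).le
    rw [abs_le] at *
    constructor <;> linarith
  have g1 : |Real.exp a - 1| ≤
      Real.exp (3 * B) * ((Real.exp B + C) * (t + W)) + |Real.exp A1 - 1| :=
    (abs_sub_le _ _ _).trans (by gcongr)
  have g2 : |Real.exp A2 - 1| ≤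
      Real.exp (3 * B) * ((Real.exp B + C) * (t + W)) + |Real.exp b - 1| :=
    (abs_sub_le _ _ _).trans (by gcongr)
  have g3 : |Real.exp A1 - 1| = δ1 / δ0 * |Real.exp A2 - 1| := by
    field_simp
    linarith
  have g4 : δ1 / δ0 ≤ Real.exp (3 * B) := by rwa [div_le_iff₀ d0]
  set R := Real.exp (3 * B) * ((Real.exp B + C) * (t + W)) with hR
  have hR0 : 0 ≤ R := by positivity
  calc _ ≤ R + δ1 / δ0 * (R + |Real.exp b - 1|) := by
        rw [g3] at g1
        exact g1.trans (by gcongr)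
    _ = R + δ1 / δ0 * R + δ1 / δ0 * |Real.exp b - 1| := by ring
    _ ≤ R + Real.exp (3 * B) * R + δ1 / δ0 * |Real.exp b - 1| := by gcongr
    _ = _ := by rw [hR]; ring

/-- The logarithms of the derivatives of the closest return maps are controlled by the sums
`∑ j ≤ n, (L (n + 1) / L (j + 1)) * w (L j)` of maximal displacements `L`. -/
theorem exists_abs_logDerivIter_le_sum (h : IsIrrationalLift w F F' F'' ρ K P Q) :
    ∃ M, 0 < M ∧ ∀ n x, |logDerivIter F F' (Q (n + 1)) x| ≤ M * ∑ j ∈ Finset.range (n + 1),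
      maxGap F P Q (n + 1) / maxGap F P Q (j + 1) * w (maxGap F P Q j) := by
  obtain ⟨B, hB⟩ := h.exists_log_deriv_lipschitz
  obtain ⟨C, hC⟩ := h.exists_logSlope_bound
  have hB0 := hB.1
  have hC0 := hC.1
  set M1 := Real.exp (6 * B) * C * (2 * Real.exp (3 * B) + Real.exp (2 * B)) with hM1
  set M2 := Real.exp (3 * B) * (Real.exp (3 * B) + 1) * (Real.exp B + C) with hM2
  have hM10 : 0 < M1 := by positivity
  have hM20 : 0 < M2 := by positivity
  have hW : ∀ n, 0 ≤ w (maxGap F P Q n) := fun n => (h.modulus.pos _ (h.maxGap_pos n)).le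
  set N := (M1 + M2) + (M1 + M2) ^ 2 * (1 + Real.exp (3 * B) + Real.exp (3 * B) ^ 2) with hN
  have hN0 : 0 < N := by positivity
  set G := 2 * Real.exp (2 * B) * (Real.exp (3 * B) + 1) ^ 2 with hG
  have hG0 : 0 < G := by positivity
  refine ⟨Real.exp (2 * B) * N * G, by positivity, fun n x => ?_⟩
  have d := fun n => h.gap_pos n x
  have h1 := le_mul_sum_of_recursion (c := Real.exp (3 * B)) (M := M1 + M2) (Real.exp_pos _).le
    (by positivity) (δ := fun n => gap F P Q n x)
    (t := fun n => |Real.exp (-(logDerivIncr F F' P Q n x) / 2) - 1|)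
    (e := fun n => |Real.exp (logDerivIter F F' (Q n) x) - 1|) (W := fun n => w (maxGap F P Q n))
    (fun n => d n) (fun n => h.gap_succ_le hB n x) (fun n => h.gap_succ_le_sub hB n x)
    (fun n => abs_nonneg _) hW (by simp [h.logDerivIncr_zero])
    (by simp [h.Q_zero, logDerivIter_zero])
    (fun n => (h.exp_logDerivIncr_succ_le hB hC n x).trans (by
      have := hW n
      have := d (n + 1)
      have := d (n + 2)
      gcongr
      linarith))
    (fun n => (h.exp_logDerivIter_succ_le hB hC n x).trans (by
      have := hW n
      gcongr
      linarith)) (n + 1)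
  have h2 := abs_le_exp_mul_abs_exp_sub_one (h.abs_logDerivIter_le hB (n + 1) x)
  calc _ ≤ Real.exp (2 * B) * (N * ∑ j ∈ Finset.range (n + 1),
        gap F P Q (n + 1) x / gap F P Q (j + 1) x * w (maxGap F P Q j)) :=
        h2.trans (mul_le_mul_of_nonneg_left h1 (Real.exp_pos _).le)
    _ ≤ Real.exp (2 * B) * (N * ∑ j ∈ Finset.range (n + 1),
        G * (maxGap F P Q (n + 1) / maxGap F P Q (j + 1)) * w (maxGap F P Q j)) := by
        gcongr with j hj
        · exact hW j
        · have := h.gap_mul_maxGap_le hB (n := n + 1) (i := j + 1)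
            (by have := Finset.mem_range.1 hj; omega) x
          rw [← mul_div_assoc, div_le_div_iff₀ (d _) (h.maxGap_pos _)]
          linarith
    _ = _ := by
        simp only [mul_assoc, ← Finset.mul_sum]

end IsIrrationalLift

theorem summable_of_half_recursion {D b : ℕ → ℝ} (hD : ∀ n, 0 ≤ D n) (hb : ∀ n, 0 ≤ b n)
    (hs : Summable b) (hrec : ∀ n, D (n + 1) = D n / 2 + b n) : Summable D := by
  refine summable_of_sum_range_le (c := 2 * (D 0 + ∑' n, b n)) hD fun n => ?_
  have ht : 0 ≤ ∑' n, b n := tsum_nonneg hb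
  have h0 := hD 0
  induction n with
  | zero => simpa using by linarith
  | succ n ih =>
    rw [Finset.sum_range_succ']
    simp only [hrec]
    rw [Finset.sum_add_distrib, ← Finset.sum_div]
    linarith [hs.sum_le_tsum (Finset.range n) fun i _ => hb i]

/-- Birkhoff-type average of the logarithmic derivatives of the first `m` iterates. -/
noncomputable def logDerivAverage (F F' : ℝ → ℝ) (m : ℕ) (x : ℝ) : ℝ :=
  (∑ j ∈ Finset.range m, logDerivIter F F' j x) / m

theorem abs_sum_logDerivIter_sub_le (F F' : ℝ → ℝ) {m : ℕ} {κ : ℝ}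
    (hκ : ∀ x, |logDerivIter F F' m x| ≤ κ) (a b : ℕ) (x : ℝ) :
    |∑ j ∈ Finset.range (a * m + b), logDerivIter F F' j x -
      (a * ∑ j ∈ Finset.range m, logDerivIter F F' j x +
        ∑ j ∈ Finset.range b, logDerivIter F F' j x)| ≤ a * (a * m + b) * κ := by
  have hκ0 : 0 ≤ κ := (abs_nonneg _).trans (hκ x)
  induction a with
  | zero => simp
  | succ a ih =>
    have h1 : (a + 1) * m + b = m + (a * m + b) := by ring
    have h2 : ∑ j ∈ Finset.range ((a + 1) * m + b), logDerivIter F F' j x =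
        ∑ j ∈ Finset.range m, logDerivIter F F' j x +
        (∑ j ∈ Finset.range (a * m + b), logDerivIter F F' j x +
          ∑ j ∈ Finset.range (a * m + b), logDerivIter F F' m (F^[j] x)) := by
      rw [h1, Finset.sum_range_add, ← Finset.sum_add_distrib]
      congr 1
      exact Finset.sum_congr rfl fun j _ => by rw [add_comm, logDerivIter_add]
    have h3 : |∑ j ∈ Finset.range (a * m + b), logDerivIter F F' m (F^[j] x)| ≤
        (a * m + b) * κ := by
      refine (Finset.abs_sum_le_sum_abs _ _).trans ((Finset.sum_le_sum fun j _ => hκ _).trans ?_)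
      simp
    rw [h2]
    have h4 : ((a + 1 : ℕ) : ℝ) * (((a + 1 : ℕ) : ℝ) * m + b) * κ =
        a * (a * m + b) * κ + (a * m + b) * κ + (a + 1) * m * κ := by
      push_cast
      ring
    have h5 : (0 : ℝ) ≤ (a + 1) * m * κ := by positivity
    rw [h4]
    rw [abs_le] at *
    push_cast
    constructor <;> linarith

namespace IsIrrationalLift

variable {w F F' F'' : ℝ → ℝ} {ρ : ℝ} {K P Q : ℕ → ℕ}

theorem continuous_logDerivIter (h : IsIrrationalLift w F F' F'' ρ K P Q) (m : ℕ) :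
    Continuous (logDerivIter F F' m) := by
  refine continuous_finsetSum _ fun i _ => ?_
  exact (h.continuous_deriv.comp (h.continuous.iterate i)).log fun x => (h.pos _).ne'

theorem continuous_logDerivAverage (h : IsIrrationalLift w F F' F'' ρ K P Q) (m : ℕ) :
    Continuous (logDerivAverage F F' m) :=
  (continuous_finsetSum _ fun j _ => h.continuous_logDerivIter j).div_const _

theorem logDerivAverage_add_one (h : IsIrrationalLift w F F' F'' ρ K P Q) (m : ℕ) (x : ℝ) :
    logDerivAverage F F' m (x + 1) = logDerivAverage F F' m x := by
  rw [logDerivAverage, logDerivAverage]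
  congr 1
  exact Finset.sum_congr rfl fun j _ => by simpa using h.logDerivIter_add_int j x 1

theorem logDerivAverage_map {m : ℕ} (hm : 0 < m) (x : ℝ) :
    logDerivAverage F F' m (F x) =
      logDerivAverage F F' m x + logDerivIter F F' m x / m - Real.log (F' x) := by
  have h1 : ∀ j, logDerivIter F F' j (F x) = logDerivIter F F' (j + 1) x - Real.log (F' x) := by
    intro j
    rw [add_comm, logDerivIter_add]
    simp [logDerivIter]
  have hm' : (0 : ℝ) < m := by exact_mod_cast hm
  have h2 : ∑ j ∈ Finset.range m, logDerivIter F F' (j + 1) x =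
      ∑ j ∈ Finset.range m, logDerivIter F F' j x + logDerivIter F F' m x := by
    rw [← Finset.sum_range_succ, Finset.sum_range_succ', logDerivIter_zero, add_zero]
  rw [logDerivAverage, logDerivAverage]
  simp only [h1]
  rw [Finset.sum_sub_distrib, h2, Finset.sum_const, Finset.card_range, nsmul_eq_mul]
  field_simp

theorem abs_logDerivAverage_sub_le (h : IsIrrationalLift w F F' F'' ρ K P Q) {κ : ℕ → ℝ}
    (hκ : ∀ n x, |logDerivIter F F' (Q (n + 1)) x| ≤ κ n) (n : ℕ) (x : ℝ) :
    |logDerivAverage F F' (Q (n + 3)) x - logDerivAverage F F' (Q (n + 2)) x| ≤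
      |logDerivAverage F F' (Q (n + 2)) x - logDerivAverage F F' (Q (n + 1)) x| / 2 +
        K (n + 1) * κ (n + 1) := by
  have h1 := abs_sum_logDerivIter_sub_le F F' (hκ (n + 1)) (K (n + 1)) (Q (n + 1)) x
  have hQ : Q (n + 3) = K (n + 1) * Q (n + 2) + Q (n + 1) := h.Q_rec (n + 1)
  have q1 : (0 : ℝ) < Q (n + 1) := by exact_mod_cast h.Q_pos n
  have q2 : (0 : ℝ) < Q (n + 2) := by exact_mod_cast h.Q_pos (n + 1)
  have q3 : (0 : ℝ) < Q (n + 3) := by exact_mod_cast h.Q_pos (n + 2)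
  have q12 : (Q (n + 1) : ℝ) ≤ Q (n + 2) := by exact_mod_cast h.Q_le_succ (n + 1)
  have hk : (1 : ℝ) ≤ K (n + 1) := by exact_mod_cast h.one_le (n + 1)
  have hQ' : (Q (n + 3) : ℝ) = K (n + 1) * Q (n + 2) + Q (n + 1) := by exact_mod_cast hQ
  have hq : (Q (n + 1) : ℝ) / Q (n + 3) ≤ 1 / 2 := by
    rw [div_le_div_iff₀ q3 two_pos, hQ']
    nlinarith
  rw [show n + 1 + 1 = n + 2 from rfl, ← hQ, ← hQ'] at h1
  have a1 : ∑ j ∈ Finset.range (Q (n + 1)), logDerivIter F F' j x =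
      Q (n + 1) * logDerivAverage F F' (Q (n + 1)) x := by rw [logDerivAverage]; field_simp
  have a2 : ∑ j ∈ Finset.range (Q (n + 2)), logDerivIter F F' j x =
      Q (n + 2) * logDerivAverage F F' (Q (n + 2)) x := by rw [logDerivAverage]; field_simp
  have a3 : ∑ j ∈ Finset.range (Q (n + 3)), logDerivIter F F' j x =
      Q (n + 3) * logDerivAverage F F' (Q (n + 3)) x := by rw [logDerivAverage]; field_simp
  rw [a1, a2, a3] at h1
  set g1 := logDerivAverage F F' (Q (n + 1)) x
  set g2 := logDerivAverage F F' (Q (n + 2)) x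
  set g3 := logDerivAverage F F' (Q (n + 3)) x
  have h2 : |(g3 - g2) + Q (n + 1) / Q (n + 3) * (g2 - g1)| ≤ K (n + 1) * κ (n + 1) := by
    have h3 : (g3 - g2) + Q (n + 1) / Q (n + 3) * (g2 - g1) =
        (Q (n + 3) * g3 - (K (n + 1) * (Q (n + 2) * g2) + Q (n + 1) * g1)) / Q (n + 3) := by
      field_simp
      rw [hQ']
      ring
    rw [h3, abs_div, abs_of_pos q3, div_le_iff₀ q3]
    linarith
  have h4 : |Q (n + 1) / Q (n + 3) * (g2 - g1)| ≤ |g2 - g1| / 2 := by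
    rw [abs_mul, abs_of_pos (by positivity)]
    have := mul_le_mul_of_nonneg_right hq (abs_nonneg (g2 - g1))
    linarith
  have h5 := abs_sub ((g3 - g2) + Q (n + 1) / Q (n + 3) * (g2 - g1))
    (Q (n + 1) / Q (n + 3) * (g2 - g1))
  rw [add_sub_cancel_right] at h5
  linarith

/-- The cocycle `-log F'` is a continuous coboundary if the derivatives of the closest return
maps are close enough to `1`. -/
theorem exists_coboundary (h : IsIrrationalLift w F F' F'' ρ K P Q) {κ : ℕ → ℝ}
    (hκ : ∀ n x, |logDerivIter F F' (Q (n + 1)) x| ≤ κ n)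
    (hs : Summable fun n => K n * κ n) :
    ∃ γ : ℝ → ℝ, Continuous γ ∧ (∀ x, γ (x + 1) = γ x) ∧
      ∀ x, γ (F x) = γ x - Real.log (F' x) := by
  have hκ0 : ∀ n, 0 ≤ κ n := fun n => (abs_nonneg _).trans (hκ n 0)
  obtain ⟨c, -, hc⟩ := exists_bound_of_periodic
    ((h.continuous_logDerivAverage (Q 2)).sub (h.continuous_logDerivAverage (Q 1)))
    (fun x => by simp only [Pi.sub_apply, h.logDerivAverage_add_one])
  let D : ℕ → ℝ := Nat.rec c fun n d => d / 2 + K (n + 1) * κ (n + 1)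
  have hDrec : ∀ n, D (n + 1) = D n / 2 + K (n + 1) * κ (n + 1) := fun n => rfl
  have hD : ∀ n x,
      |logDerivAverage F F' (Q (n + 2)) x - logDerivAverage F F' (Q (n + 1)) x| ≤ D n := by
    intro n x
    induction n with
    | zero => exact hc x
    | succ n ih =>
      refine (h.abs_logDerivAverage_sub_le hκ n x).trans ?_
      rw [hDrec]
      gcongr
  have hDs : Summable D := summable_of_half_recursion (fun n => (abs_nonneg _).trans (hD n 0))
    (fun n => mul_nonneg (Nat.cast_nonneg _) (hκ0 _)) ((summable_nat_add_iff 1).2 hs) hDrec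
  set γ : ℝ → ℝ := fun x => logDerivAverage F F' (Q 1) x +
    ∑' n, (logDerivAverage F F' (Q (n + 2)) x - logDerivAverage F F' (Q (n + 1)) x) with hγ
  have hlim : ∀ x, Tendsto (fun n => logDerivAverage F F' (Q (n + 1)) x) atTop (𝓝 (γ x)) := by
    intro x
    have h1 : Summable fun n =>
        logDerivAverage F F' (Q (n + 2)) x - logDerivAverage F F' (Q (n + 1)) x :=
      Summable.of_norm_bounded hDs fun n => hD n x
    have h2 := (h1.hasSum.tendsto_sum_nat).const_add (logDerivAverage F F' (Q 1) x)
    refine h2.congr fun n => ?_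
    rw [Finset.sum_range_sub fun n => logDerivAverage F F' (Q (n + 1)) x]
    ring
  refine ⟨γ, ?_, fun x => ?_, fun x => ?_⟩
  · exact (h.continuous_logDerivAverage _).add (continuous_tsum
      (fun n => (h.continuous_logDerivAverage _).sub (h.continuous_logDerivAverage _)) hDs
      fun n x => hD n x)
  · simp only [hγ, h.logDerivAverage_add_one]
  · have h1 : Tendsto (fun n => logDerivIter F F' (Q (n + 1)) x / Q (n + 1)) atTop (𝓝 0) := by
      refine squeeze_zero_norm (fun n => ?_) hs.tendsto_atTop_zero
      have q1 : (1 : ℝ) ≤ Q (n + 1) := by exact_mod_cast h.Q_pos n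
      have k1 : (1 : ℝ) ≤ K n := by exact_mod_cast h.one_le n
      rw [norm_div, Real.norm_eq_abs, Real.norm_of_nonneg (by positivity)]
      exact (div_le_self (abs_nonneg _) q1).trans
        ((hκ n x).trans (le_mul_of_one_le_left (hκ0 n) k1))
    have h2 := ((hlim x).add h1).sub_const (Real.log (F' x))
    rw [add_zero] at h2
    exact tendsto_nhds_unique (hlim (F x))
      (h2.congr fun n => (logDerivAverage_map (h.Q_pos n) x).symm)

theorem exists_conjugacy_of_coboundary (h : IsIrrationalLift w F F' F'' ρ K P Q) {γ : ℝ → ℝ}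
    (hγ : Continuous γ) (hp : ∀ x, γ (x + 1) = γ x)
    (hcob : ∀ x, γ (F x) = γ x - Real.log (F' x)) :
    ∃ Φ Φ' : ℝ → ℝ, Continuous Φ' ∧ (∀ x, 0 < Φ' x) ∧ (∀ x, HasDerivAt Φ (Φ' x) x) ∧
      (∀ x, Φ (x + 1) = Φ x + 1) ∧ (∀ x, Φ (F x) = Φ x + ρ) := by
  have hg : Continuous fun x => Real.exp (γ x) := Real.continuous_exp.comp hγ
  have hint : ∀ a b, IntervalIntegrable (fun x => Real.exp (γ x)) MeasureTheory.volume a b :=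
    fun a b => hg.intervalIntegrable a b
  set I := ∫ t in (0 : ℝ)..1, Real.exp (γ t) with hI
  have hI0 : 0 < I := intervalIntegral.intervalIntegral_pos_of_pos (hint 0 1)
    (fun x => Real.exp_pos _) one_pos
  set Φ : ℝ → ℝ := fun x => (∫ t in (0 : ℝ)..x, Real.exp (γ t)) / I with hΦ
  have hderiv : ∀ x, HasDerivAt Φ (Real.exp (γ x) / I) x := fun x =>
    (intervalIntegral.integral_hasDerivAt_right (hint 0 x)
      (hg.stronglyMeasurableAtFilter _ _) hg.continuousAt).div_const I
  have hper : ∀ x, Φ (x + 1) = Φ x + 1 := by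
    intro x
    have h1 : Function.Periodic (fun x => Real.exp (γ x)) 1 := fun x => by simp only [hp]
    have h2 := h1.intervalIntegral_add_eq x 0
    have h3 := intervalIntegral.integral_add_adjacent_intervals (hint 0 x) (hint x (x + 1))
    simp only [hΦ]
    rw [← h3, h2, zero_add, add_div, ← hI, div_self hI0.ne']
  have hconst : ∀ x, Φ (F x) = Φ x + (Φ (F 0) - Φ 0) := by
    intro x
    have h1 : ∀ x, HasDerivAt (fun x => Φ (F x) - Φ x) 0 x := by
      intro x
      have := ((hderiv (F x)).comp x (h.hasDerivAt x)).sub (hderiv x)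
      have h2 : Real.exp (γ (F x)) / I * F' x - Real.exp (γ x) / I = 0 := by
        rw [hcob, Real.exp_sub, Real.exp_log (h.pos x)]
        have := (h.pos x).ne'
        field_simp
        ring
      rwa [h2] at this
    have := is_const_of_deriv_eq_zero (fun x => (h1 x).differentiableAt)
      (fun x => (h1 x).deriv) x 0
    linarith
  set c := Φ (F 0) - Φ 0 with hc
  have hiter : ∀ n : ℕ, Φ (F^[n] 0) = Φ 0 + n * c := by
    intro n
    induction n with
    | zero => simp
    | succ n ih =>
      rw [Function.iterate_succ_apply', hconst, ih]
      push_cast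
      ring
  have hcont : Continuous Φ := continuous_iff_continuousAt.2 fun x => (hderiv x).continuousAt
  obtain ⟨M, -, hM⟩ := exists_bound_of_periodic (hcont.sub continuous_id)
    (fun x => by simp only [Pi.sub_apply, hper, id]; ring)
  have hlim : Tendsto (fun n : ℕ => (F^[n] 0 - 0) / (n : ℝ)) atTop (𝓝 c) := by
    rw [tendsto_iff_norm_sub_tendsto_zero]
    refine squeeze_zero' (Eventually.of_forall fun n => norm_nonneg _) ?_
      (tendsto_const_div_atTop_nhds_zero_nat (2 * M))
    filter_upwards [eventually_gt_atTop 0] with n hn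
    have hn' : (0 : ℝ) < n := by exact_mod_cast hn
    have h1 : (F^[n] 0 - 0) / (n : ℝ) - c = ((Φ 0 - 0) - (Φ (F^[n] 0) - F^[n] 0)) / n := by
      rw [hiter]
      field_simp
      ring
    rw [h1, norm_div, Real.norm_eq_abs, Real.norm_of_nonneg hn'.le]
    gcongr
    have h2 := hM 0
    have h3 := hM (F^[n] 0)
    simp only [Pi.sub_apply, id] at h2 h3
    exact (abs_sub _ _).trans (by linarith)
  have hcρ : c = ρ := tendsto_nhds_unique hlim (h.rotation 0)
  exact ⟨Φ, fun x => Real.exp (γ x) / I, hg.div_const I, fun x => by positivity, hderiv, hper,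
    fun x => by rw [hconst, hcρ]⟩

end IsIrrationalLift

theorem IsIrrationalLift.of_convergents {w F F' F'' : ℝ → ℝ} {ρ : ℝ} {k p q : ℕ → ℕ}
    (h : IsSmoothLift w F F' F'') (hirr : Irrational ρ)
    (hrot : ∀ x, Tendsto (fun n : ℕ => (F^[n] x - x) / (n : ℝ)) atTop (𝓝 ρ))
    (hk : ∀ n, 1 ≤ k (n + 1)) (hp0 : p 0 = 0) (hp1 : p 1 = 1) (hq0 : q 0 = 1) (hq1 : q 1 = k 1)
    (hprec : ∀ n, p (n + 2) = k (n + 2) * p (n + 1) + p n)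
    (hqrec : ∀ n, q (n + 2) = k (n + 2) * q (n + 1) + q n)
    (hconv : Tendsto (fun n => (p n : ℝ) / (q n : ℝ)) atTop (𝓝 ρ)) :
    IsIrrationalLift w F F' F'' ρ (fun n => k (n + 1)) (fun n => Nat.casesOn n 1 p)
      (fun n => Nat.casesOn n 0 q) where
  toIsSmoothLift := h
  irrational := hirr
  one_le := hk
  P_zero := rfl
  P_one := hp0
  Q_zero := rfl
  Q_one := hq0
  P_rec n := by
    cases n with
    | zero => simp [hp0, hp1]
    | succ n => exact hprec n
  Q_rec n := by
    cases n with
    | zero => simp [hq0, hq1]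
    | succ n => exact hqrec n
  tendsto := (tendsto_add_atTop_iff_nat 1).1 hconv
  rotation := hrot

/-- `C¹` conjugacy from the convergence of `Σ k_{n+1} τₙ`: if
`Σ_{n=0}^∞ k_{n+1} τₙ < ∞` with `τₙ = Σ_{k=0}^{n} (lₙ/l_{n−k}) ϖ(l_{n−k−1})`
(`l₋₁ := 1`), then `T` admits a `C¹` conjugacy `Φ` to the rigid rotation `R_ρ`. -/
theorem C1_conjugacy_of_summable
    (w : ℝ → ℝ) (hw : IsModulus w)
    (F F' F'' : ℝ → ℝ) (hF : StrictMono F) (hFp : ∀ x, F (x + 1) = F x + 1)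
    (hF' : ∀ x, HasDerivAt F (F' x) x) (hF'' : ∀ x, HasDerivAt F' (F'' x) x)
    (hF'pos : ∀ x, 0 < F' x)
    (hmod : ∀ x y : ℝ, x ≠ y → |F'' x - F'' y| ≤ w |x - y|)
    (ρ : ℝ) (hρ : ρ ∈ Set.Ioo (0:ℝ) 1) (hirr : Irrational ρ)
    (hrot : ∀ x : ℝ,
      Filter.Tendsto (fun n : ℕ => (F^[n] x - x) / (n : ℝ)) Filter.atTop (nhds ρ))
    (k p q : ℕ → ℕ) (hk : ∀ n, 1 ≤ k (n + 1))
    (hp0 : p 0 = 0) (hp1 : p 1 = 1) (hq0 : q 0 = 1) (hq1 : q 1 = k 1)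
    (hprec : ∀ n, p (n + 2) = k (n + 2) * p (n + 1) + p n)
    (hqrec : ∀ n, q (n + 2) = k (n + 2) * q (n + 1) + q n)
    (hconv : Filter.Tendsto (fun n => (p n : ℝ) / (q n : ℝ)) Filter.atTop (nhds ρ))
    (l : ℕ → ℝ) (hl : ∀ n, l n = ⨆ x : ℝ, |F^[q n] x - x - (p n : ℝ)|)
    (lex : ℕ → ℝ) (hlex0 : lex 0 = 1) (hlexS : ∀ n, lex (n + 1) = l n)
    (τ : ℕ → ℝ)
    (hτ : ∀ n, τ n = ∑ j ∈ Finset.range (n + 1), l n / l (n - j) * w (lex (n - j)))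
    (hsum : Summable (fun n : ℕ => (k (n + 1) : ℝ) * τ n)) :
    ∃ Φ Φ' : ℝ → ℝ, Continuous Φ' ∧ (∀ x, 0 < Φ' x) ∧
      (∀ x, HasDerivAt Φ (Φ' x) x) ∧
      (∀ x, Φ (x + 1) = Φ x + 1) ∧
      (∀ x, Φ (F x) = Φ x + ρ) := by
  obtain ⟨P, Q, hP0, hPS, hQ0, hQS, h⟩ : ∃ P Q : ℕ → ℕ, P 0 = 1 ∧ (∀ n, P (n + 1) = p n) ∧
      Q 0 = 0 ∧ (∀ n, Q (n + 1) = q n) ∧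
      IsIrrationalLift w F F' F'' ρ (fun n => k (n + 1)) P Q :=
    ⟨_, _, rfl, fun _ => rfl, rfl, fun _ => rfl,
      IsIrrationalLift.of_convergents ⟨hw, hF, hFp, hF', hF'', hF'pos, hmod⟩ hirr hrot hk
        hp0 hp1 hq0 hq1 hprec hqrec hconv⟩
  obtain ⟨M, -, hM⟩ := h.exists_abs_logDerivIter_le_sum
  have hlex : ∀ n, IsIrrationalLift.maxGap F P Q n = lex n := by
    intro n
    cases n with
    | zero => simp [IsIrrationalLift.maxGap, gap, closestReturn, hlex0, hP0, hQ0]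
    | succ n =>
      rw [hlexS, hl]
      simp only [IsIrrationalLift.maxGap, gap, closestReturn, hPS, hQS, sub_right_comm]
  have hτ' : ∀ n, ∑ j ∈ Finset.range (n + 1), lex (n + 1) / lex (j + 1) * w (lex j) = τ n := by
    intro n
    rw [hτ, ← Finset.sum_range_reflect]
    refine Finset.sum_congr rfl fun j hj => ?_
    rw [hlexS, hlexS, add_tsub_cancel_right]
  simp only [hlex, hτ'] at hM
  obtain ⟨γ, hγ, hp, hcob⟩ := h.exists_coboundary hM (by
    refine (hsum.mul_left M).congr fun n => ?_
    ring)
  exact h.exists_conjugacy_of_coboundary hγ hp hcob
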